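/- arXiv:2206.01657 — 3 statements merged into one kernel-verified Lean document; each statement's English description precedes it below -/
import Mathlib

section
/- Suppose C, K, B, and all N_j are analytic at σ_1,…,σ_k, ς_1,…,ς_κ ∈ ℂ and that K and K̂ = Wᴴ K V are invertible at all of these points. Let b ∈ ℂ^m, c ∈ ℂ^p, scaling vectors d^{(1)},…,d^{(k-1)}, δ^{(1)},…,δ^{(κ-1)} ∈ ℂ^m, and nonnegative integers ℓ_1,…,ℓ_k and ν_1,…,ν_κ be given. Let the column space of V contain the vectors v_{1,j_1} = ∂_{s^{j_1}}(K^{-1}B)(σ_1) b (j_1 = 0,…,ℓ_1) and v_{i,j_i} = ∂_{s^{j_i}}K^{-1}(σ_i) · ∂_{s^{ℓ_{i-1}}}(𝔑(·,d^{(i-1)}) K^{-1})(σ_{i-1}) ⋯ ∂_{s^{ℓ_1}}(𝔑(·,d^{(1)}) K^{-1} B)(σ_1) b (2 ≤ i ≤ k, j_i = 0,…,ℓ_i), and let the column space of W contain the vectors w_{1,i} = (∂_{s^i}(cᴴ C K^{-1})(ς_κ))ᴴ (i = 0,…,ν_κ) and w_{i,j} = (∂_{s^j}(w_{i-1,ν_{κ-i+2}}ᴴ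 𝔑(·,δ^{(κ-i+1)}) K^{-1})(ς_{κ-i+1}))ᴴ (2 ≤ i ≤ κ, j = 0,…,ν_{κ-i+1}). Then for all 1 ≤ q ≤ k, 1 ≤ η ≤ κ, every arbitrary scaling vector z ∈ ℂ^m, every j_q = 0,…,ℓ_q, and every i = 0,…,ν_{κ-η+1}, it holds that cᴴ ∂_{s_1^{ℓ_1} ⋯ s_{q-1}^{ℓ_{q-1}} s_q^{j_q} s_{q+1}^{i} s_{q+2}^{ν_{κ-η+2}} ⋯ s_{q+η}^{ν_κ}} 𝔾_{q+η}(σ_1,…,σ_q, ς_{κ-η+1},…,ς_κ | d^{(1)},…,d^{(q-1)}, z, δ^{(κ-η+1)},…,δ^{(κ-1)}) b equals the same expression with 𝔾_{q+η} replaced by the reduced-order 𝔾̂_{q+η}. -/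
open Matrix
open scoped Kronecker

namespace StructBilin

/-- Scaled sum of the bilinear terms: `𝔑(s, d) = ∑ i, d i • N i s`. -/
noncomputable def Nsum {n m : ℕ} (N : Fin m → ℂ → Matrix (Fin n) (Fin n) ℂ) (s : ℂ)
    (d : Fin m → ℂ) : Matrix (Fin n) (Fin n) ℂ :=
  ∑ i, d i • N i s

/-- Middle factor of the modified transfer function
`𝔾_{q+1}(σ 0, …, σ q | d 0, …, d (q-1)) = C (σ q) * gAux K B N σ d q`. -/
noncomputable def gAux {n m : ℕ} (K : ℂ → Matrix (Fin n) (Fin n) ℂ)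
    (B : ℂ → Matrix (Fin n) (Fin m) ℂ) (N : Fin m → ℂ → Matrix (Fin n) (Fin n) ℂ)
    (σ : ℕ → ℂ) (d : ℕ → Fin m → ℂ) : ℕ → Matrix (Fin n) (Fin m) ℂ
  | 0 => (K (σ 0))⁻¹ * B (σ 0)
  | j + 1 => (K (σ (j + 1)))⁻¹ * Nsum N (σ j) (d j) * gAux K B N σ d j

/-- The modified (scaled and summed) transfer function
`𝔾_{q+1}(σ 0, …, σ q | d 0, …, d (q-1))` (the level is `q + 1`, indices are 0-based). -/
noncomputable def Gmod {n m p : ℕ} (C : ℂ → Matrix (Fin p) (Fin n) ℂ)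
    (K : ℂ → Matrix (Fin n) (Fin n) ℂ) (B : ℂ → Matrix (Fin n) (Fin m) ℂ)
    (N : Fin m → ℂ → Matrix (Fin n) (Fin n) ℂ) (σ : ℕ → ℂ) (d : ℕ → Fin m → ℂ)
    (q : ℕ) : Matrix (Fin p) (Fin m) ℂ :=
  C (σ q) * gAux K B N σ d q

/-- Right tangential interpolation vectors:
`v 0 = K(σ 0)⁻¹ B(σ 0) b`, `v (j+1) = K(σ (j+1))⁻¹ 𝔑(σ j, d j) v j`. -/
noncomputable def vtan {n m : ℕ} (K : ℂ → Matrix (Fin n) (Fin n) ℂ)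
    (B : ℂ → Matrix (Fin n) (Fin m) ℂ) (N : Fin m → ℂ → Matrix (Fin n) (Fin n) ℂ)
    (σ : ℕ → ℂ) (d : ℕ → Fin m → ℂ) (b : Fin m → ℂ) : ℕ → Fin n → ℂ
  | 0 => (K (σ 0))⁻¹ *ᵥ (B (σ 0) *ᵥ b)
  | j + 1 => (K (σ (j + 1)))⁻¹ *ᵥ (Nsum N (σ j) (d j) *ᵥ vtan K B N σ d b j)

/-- Left tangential interpolation vectors (with reversed point sequence `τ` and
scaling sequence `e`):
`w 0 = K(τ 0)^{-ᴴ} C(τ 0)ᴴ c`, `w (t+1) = K(τ (t+1))^{-ᴴ} 𝔑(τ (t+1), e t)ᴴ w t`. -/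
noncomputable def wtan {n m p : ℕ} (C : ℂ → Matrix (Fin p) (Fin n) ℂ)
    (K : ℂ → Matrix (Fin n) (Fin n) ℂ) (N : Fin m → ℂ → Matrix (Fin n) (Fin n) ℂ)
    (τ : ℕ → ℂ) (e : ℕ → Fin m → ℂ) (c : Fin p → ℂ) : ℕ → Fin n → ℂ
  | 0 => ((K (τ 0))⁻¹)ᴴ *ᵥ ((C (τ 0))ᴴ *ᵥ c)
  | t + 1 => ((K (τ (t + 1)))⁻¹)ᴴ *ᵥ ((Nsum N (τ (t + 1)) (e t))ᴴ *ᵥ wtan C K N τ e c t)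

/-- Entrywise `t`-th complex derivative of a matrix-valued function. -/
noncomputable def mDeriv {α β : Type*} (t : ℕ) (f : ℂ → Matrix α β ℂ) (z : ℂ) :
    Matrix α β ℂ :=
  Matrix.of fun i j => iteratedDeriv t (fun w => f w i j) z

/-- Entrywise `t`-th complex derivative of a vector-valued function. -/
noncomputable def vDeriv {α : Type*} (t : ℕ) (f : ℂ → α → ℂ) (z : ℂ) : α → ℂ :=
  fun i => iteratedDeriv t (fun w => f w i) z

/-- Partial derivative in the `i`-th coordinate of a function of countably many
complex variables. -/
noncomputable def pD (i : ℕ) (f : (ℕ → ℂ) → ℂ) (s : ℕ → ℂ) : ℂ :=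
  deriv (fun z => f (Function.update s i z)) (s i)

/-- Mixed partial derivative `∂_{s_1^{ord 0} ⋯ s_t^{ord (t-1)}}` of a function of the
first `t` coordinates. -/
noncomputable def mixedD (ord : ℕ → ℕ) : ℕ → ((ℕ → ℂ) → ℂ) → (ℕ → ℂ) → ℂ
  | 0, f => f
  | t + 1, f => mixedD ord t ((pD t)^[ord t] f)

/-- The Hermite chain
`hChain t = ∂^{ℓ (t)}(𝔑(·, d t) K⁻¹)(σ t) ⋯ ∂^{ℓ 0}(𝔑(·, d 0) K⁻¹ B)(σ 0)`. -/
noncomputable def hChain {n m : ℕ} (K : ℂ → Matrix (Fin n) (Fin n) ℂ)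
    (B : ℂ → Matrix (Fin n) (Fin m) ℂ) (N : Fin m → ℂ → Matrix (Fin n) (Fin n) ℂ)
    (σ : ℕ → ℂ) (d : ℕ → Fin m → ℂ) (ℓ : ℕ → ℕ) : ℕ → Matrix (Fin n) (Fin m) ℂ
  | 0 => mDeriv (ℓ 0) (fun z => Nsum N z (d 0) * ((K z)⁻¹ * B z)) (σ 0)
  | t + 1 =>
      mDeriv (ℓ (t + 1)) (fun z => Nsum N z (d (t + 1)) * (K z)⁻¹) (σ (t + 1)) *
        hChain K B N σ d ℓ t

/-- Right tangential Hermite interpolation vectors. -/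
noncomputable def vHerm {n m : ℕ} (K : ℂ → Matrix (Fin n) (Fin n) ℂ)
    (B : ℂ → Matrix (Fin n) (Fin m) ℂ) (N : Fin m → ℂ → Matrix (Fin n) (Fin n) ℂ)
    (σ : ℕ → ℂ) (d : ℕ → Fin m → ℂ) (ℓ : ℕ → ℕ) (b : Fin m → ℂ) : ℕ → ℕ → Fin n → ℂ
  | 0, j => mDeriv j (fun z => (K z)⁻¹ * B z) (σ 0) *ᵥ b
  | t + 1, j => (mDeriv j (fun z => (K z)⁻¹) (σ (t + 1)) * hChain K B N σ d ℓ t) *ᵥ b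

/-- Left tangential Hermite interpolation vectors (with reversed sequences). -/
noncomputable def wHerm {n m p : ℕ} (C : ℂ → Matrix (Fin p) (Fin n) ℂ)
    (K : ℂ → Matrix (Fin n) (Fin n) ℂ) (N : Fin m → ℂ → Matrix (Fin n) (Fin n) ℂ)
    (τ : ℕ → ℂ) (e : ℕ → Fin m → ℂ) (eν : ℕ → ℕ) (c : Fin p → ℂ) : ℕ → ℕ → Fin n → ℂ
  | 0, i => star (vDeriv i (fun z => Matrix.vecMul (star c) (C z * (K z)⁻¹)) (τ 0))
  | t + 1, j =>
      star (vDeriv j (fun z =>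
        Matrix.vecMul (star (wHerm C K N τ e eν c t (eν t))) (Nsum N z (e t) * (K z)⁻¹))
        (τ (t + 1)))

/-- Column index type of the `j+1`-st subsystem transfer function (`m^(j+1)` indices). -/
def colT (m : ℕ) : ℕ → Type
  | 0 => Fin m
  | j + 1 => Fin m × colT m j

def colTFintype (m : ℕ) : ∀ j, Fintype (colT m j)
  | 0 => inferInstanceAs (Fintype (Fin m))
  | j + 1 => letI := colTFintype m j; inferInstanceAs (Fintype (Fin m × colT m j))

attribute [instance] colTFintype

/-- Block index type (`m^j` indices). -/
def outT (m : ℕ) : ℕ → Type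
  | 0 => Fin 1
  | j + 1 => Fin m × outT m j

def outTFintype (m : ℕ) : ∀ j, Fintype (outT m j)
  | 0 => inferInstanceAs (Fintype (Fin 1))
  | j + 1 => letI := outTFintype m j; inferInstanceAs (Fintype (Fin m × outT m j))

attribute [instance] outTFintype

/-- The horizontal concatenation `N(s) = [N_1(s) ⋯ N_m(s)]`. -/
noncomputable def Nbig {n m : ℕ} (N : Fin m → ℂ → Matrix (Fin n) (Fin n) ℂ) (s : ℂ) :
    Matrix (Fin n) (Fin m × Fin n) ℂ :=
  Matrix.of fun i q => N q.1 s i q.2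

/-- The vertical concatenation `Ñ(s)` of `N_1(s), …, N_m(s)`. -/
noncomputable def Ntil {n m : ℕ} (N : Fin m → ℂ → Matrix (Fin n) (Fin n) ℂ) (s : ℂ) :
    Matrix (Fin m × Fin n) (Fin n) ℂ :=
  Matrix.of fun q i => N q.1 s q.2 i

/-- State part of the `j+1`-st subsystem transfer function:
`Z 0 = K(σ 0)⁻¹ B(σ 0)`, `Z (j+1) = K(σ (j+1))⁻¹ N(σ j) (I_m ⊗ Z j)`. -/
noncomputable def Zblk {n m : ℕ} (K : ℂ → Matrix (Fin n) (Fin n) ℂ)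
    (B : ℂ → Matrix (Fin n) (Fin m) ℂ) (N : Fin m → ℂ → Matrix (Fin n) (Fin n) ℂ)
    (σ : ℕ → ℂ) : (j : ℕ) → Matrix (Fin n) (colT m j) ℂ
  | 0 => (K (σ 0))⁻¹ * B (σ 0)
  | j + 1 =>
      (K (σ (j + 1)))⁻¹ * Nbig N (σ j) *
        ((1 : Matrix (Fin m) (Fin m) ℂ) ⊗ₖ Zblk K B N σ j)

/-- The `q+1`-st subsystem transfer function `G_{q+1}(σ 0, …, σ q)`. -/
noncomputable def Gblk {n m p : ℕ} (C : ℂ → Matrix (Fin p) (Fin n) ℂ)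
    (K : ℂ → Matrix (Fin n) (Fin n) ℂ) (B : ℂ → Matrix (Fin n) (Fin m) ℂ)
    (N : Fin m → ℂ → Matrix (Fin n) (Fin n) ℂ) (σ : ℕ → ℂ) (q : ℕ) :
    Matrix (Fin p) (colT m q) ℂ :=
  C (σ q) * Zblk K B N σ q

/-- The tangential direction matrix `I_{m^j} ⊗ b`. -/
noncomputable def tangMat {m : ℕ} (b : Fin m → ℂ) :
    (j : ℕ) → Matrix (colT m j) (outT m j) ℂ
  | 0 => Matrix.of fun i _ => b i
  | j + 1 => (1 : Matrix (Fin m) (Fin m) ℂ) ⊗ₖ tangMat b j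

/-- Blockwise right interpolation matrices:
`V 0 = K(σ 0)⁻¹ B(σ 0) b`, `V (j+1) = K(σ (j+1))⁻¹ N(σ j) (I_m ⊗ V j)`. -/
noncomputable def Vblk {n m : ℕ} (K : ℂ → Matrix (Fin n) (Fin n) ℂ)
    (B : ℂ → Matrix (Fin n) (Fin m) ℂ) (N : Fin m → ℂ → Matrix (Fin n) (Fin n) ℂ)
    (σ : ℕ → ℂ) (b : Fin m → ℂ) : (j : ℕ) → Matrix (Fin n) (outT m j) ℂ
  | 0 => Matrix.of fun i _ => ((K (σ 0))⁻¹ *ᵥ (B (σ 0) *ᵥ b)) i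
  | j + 1 =>
      (K (σ (j + 1)))⁻¹ * Nbig N (σ j) *
        ((1 : Matrix (Fin m) (Fin m) ℂ) ⊗ₖ Vblk K B N σ b j)

/-- Blockwise left interpolation matrices (with reversed point sequence `τ`):
`W 0 = K(τ 0)^{-ᴴ} C(τ 0)ᴴ c`, `W (t+1) = K(τ (t+1))^{-ᴴ} Ñ(τ (t+1))ᴴ (I_m ⊗ W t)`. -/
noncomputable def Wblk {n m p : ℕ} (C : ℂ → Matrix (Fin p) (Fin n) ℂ)
    (K : ℂ → Matrix (Fin n) (Fin n) ℂ) (N : Fin m → ℂ → Matrix (Fin n) (Fin n) ℂ)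
    (τ : ℕ → ℂ) (c : Fin p → ℂ) : (t : ℕ) → Matrix (Fin n) (outT m t) ℂ
  | 0 => Matrix.of fun i _ => (((K (τ 0))⁻¹)ᴴ *ᵥ ((C (τ 0))ᴴ *ᵥ c)) i
  | t + 1 =>
      ((K (τ (t + 1)))⁻¹)ᴴ * (Ntil N (τ (t + 1)))ᴴ *
        ((1 : Matrix (Fin m) (Fin m) ℂ) ⊗ₖ Wblk C K N τ c t)

/-- A vector as a one-column matrix. -/
noncomputable def bCol {m : ℕ} (b : Fin m → ℂ) : Matrix (Fin m) (Fin 1) ℂ :=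
  Matrix.of fun i _ => b i

/-- Blockwise Hermite chain. -/
noncomputable def hChainB {n m : ℕ} (K : ℂ → Matrix (Fin n) (Fin n) ℂ)
    (B : ℂ → Matrix (Fin n) (Fin m) ℂ) (N : Fin m → ℂ → Matrix (Fin n) (Fin n) ℂ)
    (σ : ℕ → ℂ) (ℓ : ℕ → ℕ) (b : Fin m → ℂ) :
    (t : ℕ) → Matrix (Fin n) (outT m (t + 1)) ℂ
  | 0 => mDeriv (ℓ 0)
      (fun z => Nbig N z * ((1 : Matrix (Fin m) (Fin m) ℂ) ⊗ₖ ((K z)⁻¹ * B z * bCol b)))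
      (σ 0)
  | t + 1 =>
      mDeriv (ℓ (t + 1))
        (fun z => Nbig N z * ((1 : Matrix (Fin m) (Fin m) ℂ) ⊗ₖ (K z)⁻¹)) (σ (t + 1)) *
        ((1 : Matrix (Fin m) (Fin m) ℂ) ⊗ₖ hChainB K B N σ ℓ b t)

/-- Blockwise right Hermite interpolation matrices. -/
noncomputable def vHermB {n m : ℕ} (K : ℂ → Matrix (Fin n) (Fin n) ℂ)
    (B : ℂ → Matrix (Fin n) (Fin m) ℂ) (N : Fin m → ℂ → Matrix (Fin n) (Fin n) ℂ)
    (σ : ℕ → ℂ) (ℓ : ℕ → ℕ) (b : Fin m → ℂ) : (t : ℕ) → ℕ → Matrix (Fin n) (outT m t) ℂ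
  | 0, j => mDeriv j (fun z => (K z)⁻¹ * B z * bCol b) (σ 0)
  | t + 1, j => mDeriv j (fun z => (K z)⁻¹) (σ (t + 1)) * hChainB K B N σ ℓ b t

/-- Blockwise left Hermite interpolation matrices (with reversed sequences). -/
noncomputable def wHermB {n m p : ℕ} (C : ℂ → Matrix (Fin p) (Fin n) ℂ)
    (K : ℂ → Matrix (Fin n) (Fin n) ℂ) (N : Fin m → ℂ → Matrix (Fin n) (Fin n) ℂ)
    (τ : ℕ → ℂ) (eν : ℕ → ℕ) (c : Fin p → ℂ) : (t : ℕ) → ℕ → Matrix (Fin n) (outT m t) ℂ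
  | 0, i => Matrix.of fun idx _ =>
      star (iteratedDeriv i (fun z => Matrix.vecMul (star c) (C z * (K z)⁻¹) idx) (τ 0))
  | t + 1, j => Matrix.of fun idx cc =>
      star (iteratedDeriv j (fun z =>
        (((1 : Matrix (Fin m) (Fin m) ℂ) ⊗ₖ wHermB C K N τ eν c t (eν t))ᴴ * Ntil N z *
          (K z)⁻¹) cc idx) (τ (t + 1)))

/-- The Kronecker product `d (j-1) ⊗ ⋯ ⊗ d 0 ⊗ I_m` of scaling vectors with the identity. -/
noncomputable def dKron {m : ℕ} (d : ℕ → Fin m → ℂ) :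
    (j : ℕ) → Matrix (colT m j) (Fin m) ℂ
  | 0 => (1 : Matrix (Fin m) (Fin m) ℂ)
  | j + 1 => Matrix.of fun (pq : Fin m × colT m j) cix => d j pq.1 * dKron d j pq.2 cix

/-- The innermost (input) coordinate of a column multi-index. -/
def innerIdx (m : ℕ) : (j : ℕ) → colT m j → Fin m
  | 0 => fun x => x
  | j + 1 => fun (pq : Fin m × colT m j) => innerIdx m j pq.2

/-- The chain `K(σ t)⁻¹ N_{J (t-1)}(σ (t-1)) ⋯ N_{J 0}(σ 0) K(σ 0)⁻¹ B(σ 0)`. -/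
noncomputable def eChain {n m : ℕ} (K : ℂ → Matrix (Fin n) (Fin n) ℂ)
    (B : ℂ → Matrix (Fin n) (Fin m) ℂ) (N : Fin m → ℂ → Matrix (Fin n) (Fin n) ℂ)
    (σ : ℕ → ℂ) (J : ℕ → Fin m) : ℕ → Matrix (Fin n) (Fin m) ℂ
  | 0 => (K (σ 0))⁻¹ * B (σ 0)
  | t + 1 => (K (σ (t + 1)))⁻¹ * N (J t) (σ t) * eChain K B N σ J t

/-- Entrywise analyticity of a matrix-valued function at a point. -/
def MAnalyticAt {α β : Type*} (f : ℂ → Matrix α β ℂ) (z : ℂ) : Prop :=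
  ∀ a e, AnalyticAt ℂ (fun w => f w a e) z

section MatrixCalculus

variable {α β γ : Type*} {x : ℂ}

theorem mAnalyticAt_const (Y : Matrix α β ℂ) : MAnalyticAt (fun _ => Y) x :=
  fun _ _ => analyticAt_const

theorem MAnalyticAt.mul [Fintype β] {f : ℂ → Matrix α β ℂ} {g : ℂ → Matrix β γ ℂ}
    (hf : MAnalyticAt f x) (hg : MAnalyticAt g x) : MAnalyticAt (fun z => f z * g z) x := by
  intro a e
  simp only [Matrix.mul_apply]
  exact Finset.analyticAt_fun_sum _ fun i _ => (hf a i).mul (hg i e)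

theorem MAnalyticAt.sub {f g : ℂ → Matrix α β ℂ}
    (hf : MAnalyticAt f x) (hg : MAnalyticAt g x) : MAnalyticAt (fun z => f z - g z) x :=
  fun a e => (hf a e).sub (hg a e)

theorem MAnalyticAt.det [Fintype α] [DecidableEq α] {f : ℂ → Matrix α α ℂ}
    (hf : MAnalyticAt f x) : AnalyticAt ℂ (fun z => (f z).det) x := by
  simp only [Matrix.det_apply']
  exact Finset.analyticAt_fun_sum _ fun τ _ =>
    analyticAt_const.mul (Finset.analyticAt_fun_prod _ fun i _ => hf (τ i) i)

theorem MAnalyticAt.inv [Fintype α] [DecidableEq α] {f : ℂ → Matrix α α ℂ}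
    (hf : MAnalyticAt f x) (hx : IsUnit (f x).det) : MAnalyticAt (fun z => (f z)⁻¹) x := by
  intro a e
  simp only [Matrix.inv_def, Matrix.smul_apply, smul_eq_mul, Ring.inverse_eq_inv',
    Matrix.adjugate_apply]
  refine (hf.det.inv hx.ne_zero).mul (MAnalyticAt.det fun i j => ?_)
  simp only [Matrix.updateRow_apply]
  split_ifs
  · exact analyticAt_const
  · exact hf i j

theorem MAnalyticAt.eventually_isUnit_det [Fintype α] [DecidableEq α] {f : ℂ → Matrix α α ℂ}
    (hf : MAnalyticAt f x) (hx : IsUnit (f x).det) :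
    ∀ᶠ z in nhds x, IsUnit (f z).det := by
  filter_upwards [hf.det.continuousAt.eventually_ne hx.ne_zero] with z hz
  exact isUnit_iff_ne_zero.2 hz

theorem mDeriv_congr {f g : ℂ → Matrix α β ℂ} (h : f =ᶠ[nhds x] g) (k : ℕ) :
    mDeriv k f x = mDeriv k g x := by
  ext a e
  exact Filter.EventuallyEq.iteratedDeriv_eq k (h.mono fun z hz => congrFun (congrFun hz a) e)

theorem mDeriv_zero_fun (k : ℕ) : mDeriv k (fun _ => (0 : Matrix α β ℂ)) x = 0 := by
  ext a e
  simp [mDeriv]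

theorem mDeriv_sub {f g : ℂ → Matrix α β ℂ} (hf : MAnalyticAt f x) (hg : MAnalyticAt g x)
    (k : ℕ) : mDeriv k (fun z => f z - g z) x = mDeriv k f x - mDeriv k g x := by
  ext a e
  exact iteratedDeriv_sub (hf a e).contDiffAt (hg a e).contDiffAt

/-- The Leibniz rule for products of matrix-valued functions. -/
theorem mDeriv_mul [Fintype β] {f : ℂ → Matrix α β ℂ} {g : ℂ → Matrix β γ ℂ}
    (hf : MAnalyticAt f x) (hg : MAnalyticAt g x) (k : ℕ) :
    mDeriv k (fun z => f z * g z) x =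
      ∑ i ∈ Finset.range (k + 1), (k.choose i : ℂ) • (mDeriv i f x * mDeriv (k - i) g x) := by
  ext a e
  have h : ∀ l, iteratedDeriv k (fun z => f z a l * g z l e) x =
      ∑ i ∈ Finset.range (k + 1), (k.choose i : ℂ) *
        iteratedDeriv i (fun z => f z a l) x * iteratedDeriv (k - i) (fun z => g z l e) x :=
    fun l => iteratedDeriv_mul (hf a l).contDiffAt (hg l e).contDiffAt
  simp only [mDeriv, Matrix.mul_apply, Matrix.of_apply, Matrix.sum_apply, Matrix.smul_apply,
    smul_eq_mul]
  rw [iteratedDeriv_fun_sum fun l _ => ((hf a l).fun_mul (hg l e)).contDiffAt]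
  simp only [h, Finset.mul_sum]
  rw [Finset.sum_comm]
  simp only [mul_assoc]

theorem mDeriv_const_mul [Fintype β] {g : ℂ → Matrix β γ ℂ} (Y : Matrix α β ℂ)
    (hg : MAnalyticAt g x) (k : ℕ) :
    mDeriv k (fun z => Y * g z) x = Y * mDeriv k g x := by
  ext a e
  simp only [mDeriv, Matrix.mul_apply, Matrix.of_apply]
  rw [iteratedDeriv_fun_sum fun l _ => (analyticAt_const.fun_mul (hg l e)).contDiffAt]
  exact Finset.sum_congr rfl fun l _ => iteratedDeriv_const_mul _ (hg l e).contDiffAt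

theorem mDeriv_mul_const [Fintype β] {f : ℂ → Matrix α β ℂ} (Y : Matrix β γ ℂ)
    (hf : MAnalyticAt f x) (k : ℕ) :
    mDeriv k (fun z => f z * Y) x = mDeriv k f x * Y := by
  ext a e
  simp only [mDeriv, Matrix.mul_apply, Matrix.of_apply]
  rw [iteratedDeriv_fun_sum fun l _ => ((hf a l).fun_mul analyticAt_const).contDiffAt]
  refine Finset.sum_congr rfl fun l _ => ?_
  simp only [mul_comm _ (Y l e)]
  exact iteratedDeriv_const_mul _ (hf a l).contDiffAt

theorem vDeriv_vecMul [Fintype α] {f : ℂ → Matrix α β ℂ} (y : α → ℂ)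
    (hf : MAnalyticAt f x) (k : ℕ) :
    vDeriv k (fun z => y ᵥ* f z) x = y ᵥ* mDeriv k f x := by
  ext e
  simp only [vDeriv, mDeriv, Matrix.vecMul, dotProduct, Matrix.of_apply]
  rw [iteratedDeriv_fun_sum fun l _ => (analyticAt_const.fun_mul (hf l e)).contDiffAt]
  exact Finset.sum_congr rfl fun l _ => iteratedDeriv_const_mul _ (hf l e).contDiffAt

theorem mDeriv_mul_mulVec [Fintype β] [Fintype γ] {f : ℂ → Matrix α β ℂ}
    {g : ℂ → Matrix β γ ℂ} (hf : MAnalyticAt f x) (hg : MAnalyticAt g x) (k : ℕ) (b : γ → ℂ) :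
    mDeriv k (fun z => f z * g z) x *ᵥ b =
      ∑ i ∈ Finset.range (k + 1),
        (k.choose i : ℂ) • (mDeriv i f x *ᵥ (mDeriv (k - i) g x *ᵥ b)) := by
  rw [mDeriv_mul hf hg, Matrix.sum_mulVec]
  simp only [Matrix.smul_mulVec, Matrix.mulVec_mulVec]

theorem vecMul_mDeriv_mul [Fintype α] [Fintype β] {f : ℂ → Matrix α β ℂ}
    {g : ℂ → Matrix β γ ℂ} (hf : MAnalyticAt f x) (hg : MAnalyticAt g x) (k : ℕ) (y : α → ℂ) :
    y ᵥ* mDeriv k (fun z => f z * g z) x =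
      ∑ i ∈ Finset.range (k + 1),
        (k.choose i : ℂ) • ((y ᵥ* mDeriv i f x) ᵥ* mDeriv (k - i) g x) := by
  rw [mDeriv_mul hf hg, Matrix.vecMul_sum]
  simp only [Matrix.vecMul_smul, Matrix.vecMul_vecMul]

end MatrixCalculus

section Projection

variable {ι ρ γ : Type*} [Fintype ι] [DecidableEq ι] [Fintype ρ] [DecidableEq ρ] [Fintype γ]
  {x : ℂ}

/-- Derivatives of `K⁻¹ U` in a direction `b` which lie in the range of `V` are reproduced by the
Petrov–Galerkin projection. -/
theorem mDeriv_inv_mul_mulVec_eq {K : ℂ → Matrix ι ι ℂ} {U : ℂ → Matrix ι γ ℂ}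
    {V W : Matrix ι ρ ℂ} (hKa : MAnalyticAt K x) (hUa : MAnalyticAt U x)
    (hK : IsUnit (K x).det) (hKr : IsUnit (Wᴴ * K x * V).det) (b : γ → ℂ) {L : ℕ}
    (h : ∀ j ≤ L, mDeriv j (fun z => (K z)⁻¹ * U z) x *ᵥ b ∈ Set.range V.mulVec)
    {j : ℕ} (hj : j ≤ L) :
    mDeriv j (fun z => (K z)⁻¹ * U z) x *ᵥ b =
      V *ᵥ (mDeriv j (fun z => (Wᴴ * K z * V)⁻¹ * (Wᴴ * U z)) x *ᵥ b) := by
  have hRa : MAnalyticAt (fun z => Wᴴ * K z * V) x :=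
    ((mAnalyticAt_const _).mul hKa).mul (mAnalyticAt_const _)
  have hF : MAnalyticAt (fun z => (K z)⁻¹ * U z) x := (hKa.inv hK).mul hUa
  have hG : MAnalyticAt (fun z => (Wᴴ * K z * V)⁻¹ * (Wᴴ * U z)) x :=
    (hRa.inv hKr).mul ((mAnalyticAt_const _).mul hUa)
  have hP : MAnalyticAt (fun z => 1 - V * ((Wᴴ * K z * V)⁻¹ * (Wᴴ * K z))) x :=
    (mAnalyticAt_const 1).sub ((mAnalyticAt_const V).mul
      ((hRa.inv hKr).mul ((mAnalyticAt_const _).mul hKa)))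
  have hPV : ∀ i, mDeriv i (fun z => 1 - V * ((Wᴴ * K z * V)⁻¹ * (Wᴴ * K z))) x * V = 0 := by
    intro i
    rw [← mDeriv_mul_const V hP, ← mDeriv_zero_fun (x := x) i]
    refine mDeriv_congr ?_ i
    filter_upwards [hRa.eventually_isUnit_det hKr] with z hz
    have := Matrix.nonsing_inv_mul _ hz
    simp only [Matrix.mul_assoc] at this
    simp only [Matrix.sub_mul, Matrix.mul_assoc, Matrix.one_mul, this, Matrix.mul_one, sub_self]
  have hev : mDeriv j (fun z => (1 - V * ((Wᴴ * K z * V)⁻¹ * (Wᴴ * K z))) *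
      ((K z)⁻¹ * U z)) x =
      mDeriv j (fun z => (K z)⁻¹ * U z - V * ((Wᴴ * K z * V)⁻¹ * (Wᴴ * U z))) x := by
    refine mDeriv_congr ?_ j
    filter_upwards [hKa.eventually_isUnit_det hK] with z hz
    simp only [Matrix.sub_mul, Matrix.mul_assoc, Matrix.one_mul,
      Matrix.mul_nonsing_inv_cancel_left _ _ hz]
  have h0 : mDeriv j (fun z => (1 - V * ((Wᴴ * K z * V)⁻¹ * (Wᴴ * K z))) *
      ((K z)⁻¹ * U z)) x *ᵥ b = 0 := by
    rw [mDeriv_mul_mulVec hP hF]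
    refine Finset.sum_eq_zero fun i _ => ?_
    obtain ⟨y, hy⟩ := h (j - i) ((Nat.sub_le _ _).trans hj)
    rw [← hy, Matrix.mulVec_mulVec, hPV, Matrix.zero_mulVec, smul_zero]
  rw [hev, mDeriv_sub hF ((mAnalyticAt_const V).mul hG), mDeriv_const_mul V hG,
    Matrix.sub_mulVec, ← Matrix.mulVec_mulVec, sub_eq_zero] at h0
  exact h0

/-- Derivatives of `U K⁻¹` in a row direction `y` which lie in the row space of `Wᴴ` are reproduced
by the Petrov–Galerkin projection. -/
theorem vecMul_mDeriv_mul_inv_eq {K : ℂ → Matrix ι ι ℂ} {U : ℂ → Matrix γ ι ℂ}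
    {V W : Matrix ι ρ ℂ} (hKa : MAnalyticAt K x) (hUa : MAnalyticAt U x)
    (hK : IsUnit (K x).det) (hKr : IsUnit (Wᴴ * K x * V).det) (y : γ → ℂ) {L : ℕ}
    (h : ∀ j ≤ L, ∃ u, y ᵥ* mDeriv j (fun z => U z * (K z)⁻¹) x = u ᵥ* Wᴴ)
    {j : ℕ} (hj : j ≤ L) :
    y ᵥ* mDeriv j (fun z => U z * (K z)⁻¹) x =
      (y ᵥ* mDeriv j (fun z => U z * V * (Wᴴ * K z * V)⁻¹) x) ᵥ* Wᴴ := by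
  have hRa : MAnalyticAt (fun z => Wᴴ * K z * V) x :=
    ((mAnalyticAt_const _).mul hKa).mul (mAnalyticAt_const _)
  have hF : MAnalyticAt (fun z => U z * (K z)⁻¹) x := hUa.mul (hKa.inv hK)
  have hG : MAnalyticAt (fun z => U z * V * (Wᴴ * K z * V)⁻¹) x :=
    (hUa.mul (mAnalyticAt_const _)).mul (hRa.inv hKr)
  have hP : MAnalyticAt (fun z => 1 - K z * V * (Wᴴ * K z * V)⁻¹ * Wᴴ) x :=
    (mAnalyticAt_const 1).sub (((hKa.mul (mAnalyticAt_const V)).mul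
      (hRa.inv hKr)).mul (mAnalyticAt_const _))
  have hPW : ∀ i, Wᴴ * mDeriv i (fun z => 1 - K z * V * (Wᴴ * K z * V)⁻¹ * Wᴴ) x = 0 := by
    intro i
    rw [← mDeriv_const_mul Wᴴ hP, ← mDeriv_zero_fun (x := x) i]
    refine mDeriv_congr ?_ i
    filter_upwards [hRa.eventually_isUnit_det hKr] with z hz
    have := Matrix.mul_nonsing_inv _ hz
    simp only [Matrix.mul_sub, ← Matrix.mul_assoc, Matrix.mul_one, this, Matrix.one_mul, sub_self]
  have hev : mDeriv j (fun z => U z * (K z)⁻¹ *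
      (1 - K z * V * (Wᴴ * K z * V)⁻¹ * Wᴴ)) x =
      mDeriv j (fun z => U z * (K z)⁻¹ - U z * V * (Wᴴ * K z * V)⁻¹ * Wᴴ) x := by
    refine mDeriv_congr ?_ j
    filter_upwards [hKa.eventually_isUnit_det hK] with z hz
    simp only [Matrix.mul_sub, ← Matrix.mul_assoc, Matrix.mul_one,
      Matrix.nonsing_inv_mul_cancel_right _ _ hz]
  have h0 : y ᵥ* mDeriv j (fun z => U z * (K z)⁻¹ *
      (1 - K z * V * (Wᴴ * K z * V)⁻¹ * Wᴴ)) x = 0 := by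
    rw [vecMul_mDeriv_mul hF hP]
    refine Finset.sum_eq_zero fun i hi => ?_
    obtain ⟨u, hu⟩ := h i ((Nat.lt_succ_iff.1 (Finset.mem_range.1 hi)).trans hj)
    rw [hu, Matrix.vecMul_vecMul, hPW, Matrix.vecMul_zero, smul_zero]
  rw [hev, mDeriv_sub hF (hG.mul (mAnalyticAt_const _)), mDeriv_mul_const _ hG,
    Matrix.vecMul_sub, ← Matrix.vecMul_vecMul, sub_eq_zero] at h0
  exact h0

end Projection

section MixedDerivatives

theorem pD_iterate (t k : ℕ) (f : (ℕ → ℂ) → ℂ) (s : ℕ → ℂ) :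
    (pD t)^[k] f s = iteratedDeriv k (fun z => f (Function.update s t z)) (s t) := by
  induction k generalizing s with
  | zero => simp
  | succ k ih =>
    rw [Function.iterate_succ_apply', pD, iteratedDeriv_succ]
    simp only [ih, Function.update_idem, Function.update_self]

theorem mixedD_congr (ord : ℕ → ℕ) (t : ℕ) {f g : (ℕ → ℂ) → ℂ} {s : ℕ → ℂ}
    (h : ∀ s', (∀ j, t ≤ j → s' j = s j) → f s' = g s') :
    mixedD ord t f s = mixedD ord t g s := by
  induction t generalizing f g with
  | zero => exact h s fun _ _ => rfl
  | succ t ih =>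
    refine ih fun s' hs' => ?_
    rw [pD_iterate, pD_iterate]
    congr 1
    funext z
    refine h _ fun j hj => ?_
    rw [Function.update_of_ne (by lia), hs' j (by lia)]

/-- The outermost derivative of a product whose right factor does not depend on the last
variable. -/
theorem mixedD_succ_mul {α β γ : Type*} [Fintype β] (ord : ℕ → ℕ) (t : ℕ)
    {A : ℂ → Matrix α β ℂ} {R : (ℕ → ℂ) → Matrix β γ ℂ} {s : ℕ → ℂ}
    (hA : MAnalyticAt A (s t)) (hR : ∀ s z, R (Function.update s t z) = R s) (a : α) (e : γ) :
    mixedD ord (t + 1) (fun s => (A (s t) * R s) a e) s =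
      mixedD ord t (fun s' => (mDeriv (ord t) A (s t) * R s') a e) s := by
  refine mixedD_congr ord t fun s' hs' => ?_
  rw [pD_iterate]
  simp only [Function.update_self, hR, hs' t le_rfl]
  rw [← mDeriv_mul_const _ hA]
  rfl

end MixedDerivatives

section System

variable {n m p : ℕ} {C : ℂ → Matrix (Fin p) (Fin n) ℂ} {K : ℂ → Matrix (Fin n) (Fin n) ℂ}
  {B : ℂ → Matrix (Fin n) (Fin m) ℂ} {N : Fin m → ℂ → Matrix (Fin n) (Fin n) ℂ}
  {s : ℕ → ℂ} {d : ℕ → Fin m → ℂ}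

theorem mAnalyticAt_Nsum {x : ℂ} (hN : ∀ ι, MAnalyticAt (N ι) x) (d : Fin m → ℂ) :
    MAnalyticAt (fun z => Nsum N z d) x := by
  intro a e
  simp only [Nsum, Matrix.sum_apply, Matrix.smul_apply, smul_eq_mul]
  exact Finset.analyticAt_fun_sum _ fun i _ => analyticAt_const.mul (hN i a e)

theorem Nsum_projection {r : ℕ} (V W : Matrix (Fin n) (Fin r) ℂ) (x : ℂ) (d : Fin m → ℂ) :
    Nsum (fun ι z => Wᴴ * N ι z * V) x d = Wᴴ * Nsum N x d * V := by
  simp only [Nsum, Matrix.mul_sum, Matrix.sum_mul, Matrix.mul_smul, Matrix.smul_mul]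

theorem gAux_congr {s' : ℕ → ℂ} {t : ℕ} (h : ∀ j ≤ t, s' j = s j) :
    gAux K B N s' d t = gAux K B N s d t := by
  induction t with
  | zero => simp only [gAux, h 0 le_rfl]
  | succ t ih =>
    simp only [gAux, h (t + 1) le_rfl, h t (Nat.le_succ t), ih fun j hj => h j (by lia)]

theorem hChain_congr {s' : ℕ → ℂ} {d' : ℕ → Fin m → ℂ} {o o' : ℕ → ℕ} {t : ℕ}
    (hs : ∀ j ≤ t, s' j = s j) (hd : ∀ j ≤ t, d' j = d j) (ho : ∀ j ≤ t, o' j = o j) :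
    hChain K B N s' d' o' t = hChain K B N s d o t := by
  induction t with
  | zero => simp only [hChain, hs 0 le_rfl, hd 0 le_rfl, ho 0 le_rfl]
  | succ t ih =>
    simp only [hChain, hs (t + 1) le_rfl, hd (t + 1) le_rfl, ho (t + 1) le_rfl,
      ih (fun j hj => hs j (by lia)) (fun j hj => hd j (by lia)) fun j hj => ho j (by lia)]

theorem vHerm_congr {s' : ℕ → ℂ} {d' : ℕ → Fin m → ℂ} {o o' : ℕ → ℕ} {b : Fin m → ℂ}
    {t : ℕ} (hs : ∀ j ≤ t, s' j = s j) (hd : ∀ j < t, d' j = d j) (ho : ∀ j < t, o' j = o j)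
    (i : ℕ) : vHerm K B N s' d' o' b t i = vHerm K B N s d o b t i := by
  cases t with
  | zero => simp only [vHerm, hs 0 le_rfl]
  | succ t =>
    simp only [vHerm, hs (t + 1) le_rfl]
    rw [hChain_congr (fun j hj => hs j (by lia)) (fun j hj => hd j (by lia))
      fun j hj => ho j (by lia)]

theorem wHerm_congr {s' : ℕ → ℂ} {d' : ℕ → Fin m → ℂ} {o o' : ℕ → ℕ} {c : Fin p → ℂ}
    {t : ℕ} (hs : ∀ j ≤ t, s' j = s j) (hd : ∀ j < t, d' j = d j) (ho : ∀ j < t, o' j = o j)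
    (i : ℕ) : wHerm C K N s' d' o' c t i = wHerm C K N s d o c t i := by
  induction t generalizing i with
  | zero => simp only [wHerm, hs 0 le_rfl]
  | succ t ih =>
    simp only [wHerm, hs (t + 1) le_rfl, hd t t.lt_succ_self, ho t t.lt_succ_self,
      ih (fun j hj => hs j (by lia)) (fun j hj => hd j (by lia)) fun j hj => ho j (by lia)]

theorem mixedD_const_mul_Nsum_gAux {α : Type*} (ord : ℕ → ℕ) (t : ℕ)
    (hKa : ∀ j ≤ t, MAnalyticAt K (s j)) (hBa : MAnalyticAt B (s 0))
    (hNa : ∀ j ≤ t, ∀ ι, MAnalyticAt (N ι) (s j)) (hK : ∀ j ≤ t, IsUnit (K (s j)).det)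
    (Y : Matrix α (Fin n) ℂ) (a : α) (e : Fin m) :
    mixedD ord (t + 1) (fun s => (Y * (Nsum N (s t) (d t) * gAux K B N s d t)) a e) s =
      (Y * hChain K B N s d ord t) a e := by
  induction t generalizing Y with
  | zero =>
    have hA : MAnalyticAt (fun z => Nsum N z (d 0) * ((K z)⁻¹ * B z)) (s 0) :=
      (mAnalyticAt_Nsum (hNa 0 le_rfl) _).mul (((hKa 0 le_rfl).inv (hK 0 le_rfl)).mul hBa)
    have := mixedD_succ_mul (R := fun _ => (1 : Matrix (Fin m) (Fin m) ℂ)) ord 0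
      ((mAnalyticAt_const Y).mul hA) (fun _ _ => rfl) a e
    simp only [Matrix.mul_one, mDeriv_const_mul Y hA] at this
    exact this
  | succ t ih =>
    have hA : MAnalyticAt (fun z => Nsum N z (d (t + 1)) * (K z)⁻¹) (s (t + 1)) :=
      (mAnalyticAt_Nsum (hNa _ le_rfl) _).mul ((hKa _ le_rfl).inv (hK _ le_rfl))
    have := mixedD_succ_mul (R := fun s => Nsum N (s t) (d t) * gAux K B N s d t) ord (t + 1)
      ((mAnalyticAt_const Y).mul hA) (fun s z => by
        rw [Function.update_of_ne (by lia),
          gAux_congr fun j hj => Function.update_of_ne (by lia) _ _]) a e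
    rw [ih (fun j hj => hKa j (by lia)) (fun j hj => hNa j (by lia)) (fun j hj => hK j (by lia)),
      mDeriv_const_mul Y hA] at this
    simp only [Matrix.mul_assoc, gAux, hChain] at this ⊢
    exact this

/-- Mixed derivatives of the modified transfer functions factor into one-variable derivatives. -/
theorem mixedD_Gmod (ord : ℕ → ℕ) (t : ℕ) (hCa : MAnalyticAt C (s (t + 1)))
    (hKa : ∀ j ≤ t + 1, MAnalyticAt K (s j)) (hBa : MAnalyticAt B (s 0))
    (hNa : ∀ j ≤ t, ∀ ι, MAnalyticAt (N ι) (s j)) (hK : ∀ j ≤ t + 1, IsUnit (K (s j)).det) :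
    (Matrix.of fun a e => mixedD ord (t + 2) (fun s => Gmod C K B N s d (t + 1) a e) s) =
      mDeriv (ord (t + 1)) (fun z => C z * (K z)⁻¹) (s (t + 1)) * hChain K B N s d ord t := by
  ext a e
  have hA : MAnalyticAt (fun z => C z * (K z)⁻¹) (s (t + 1)) :=
    hCa.mul ((hKa _ le_rfl).inv (hK _ le_rfl))
  have := mixedD_succ_mul (R := fun s => Nsum N (s t) (d t) * gAux K B N s d t) ord (t + 1)
    hA (fun s z => by
      rw [Function.update_of_ne (by lia),
        gAux_congr fun j hj => Function.update_of_ne (by lia) _ _]) a e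
  rw [mixedD_const_mul_Nsum_gAux ord t (fun j hj => hKa j (by lia)) hBa hNa
    fun j hj => hK j (by lia)] at this
  simp only [Matrix.mul_assoc] at this
  simp only [Matrix.of_apply, Gmod, gAux, Matrix.mul_assoc]
  exact this

/-- Evaluation of the leading factors of a derivative of the modified transfer function by a left
Hermite interpolation vector. -/
theorem star_dotProduct_mDeriv_mul_hChain (ord : ℕ → ℕ) (T : ℕ) (b : Fin m → ℂ) (c : Fin p → ℂ)
    (hCa : MAnalyticAt C (s (T + 1)))
    (hKa : ∀ j ≤ T + 1, MAnalyticAt K (s j)) (hNa : ∀ j ≤ T, ∀ ι, MAnalyticAt (N ι) (s j))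
    (hK : ∀ j ≤ T + 1, IsUnit (K (s j)).det) {t : ℕ} (ht : t ≤ T) :
    star c ⬝ᵥ ((mDeriv (ord (T + 1)) (fun z => C z * (K z)⁻¹) (s (T + 1)) *
        hChain K B N s d ord T) *ᵥ b) =
      star (wHerm C K N (fun j => s (T + 1 - j)) (fun j => d (T - j))
        (fun j => ord (T + 1 - j)) c t (ord (T + 1 - t))) ⬝ᵥ
          (hChain K B N s d ord (T - t) *ᵥ b) := by
  induction t with
  | zero =>
    simp only [wHerm, star_star, Nat.sub_zero]
    rw [vDeriv_vecMul _ (hCa.mul ((hKa _ le_rfl).inv (hK _ le_rfl))), ← Matrix.mulVec_mulVec,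
      Matrix.dotProduct_mulVec]
  | succ t ih =>
    obtain ⟨u, rfl⟩ : ∃ u, T = u + 1 + t := ⟨T - t - 1, by lia⟩
    rw [ih (by lia)]
    have e1 : u + 1 + t + 1 - (t + 1) = u + 1 := by lia
    have e2 : u + 1 + t - t = u + 1 := by lia
    have e3 : u + 1 + t - (t + 1) = u := by lia
    simp only [wHerm, star_star, e1, e2, e3, hChain]
    rw [vDeriv_vecMul _ ((mAnalyticAt_Nsum (hNa _ (by lia)) _).mul
      ((hKa _ (by lia)).inv (hK _ (by lia)))), ← Matrix.mulVec_mulVec, Matrix.dotProduct_mulVec]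

section Reduction

variable {r : ℕ} {V W : Matrix (Fin n) (Fin r) ℂ}

/-- If `G` reproduces the derivatives of `F` through `V`, then `𝔑̂ G` reproduces those of `𝔑 F`
through `Wᴴ`. -/
theorem mDeriv_Nsum_mul_projection {γ γ' : Type*} [Fintype γ] [Fintype γ'] {x : ℂ} {b : γ → ℂ} {L : ℕ}
    {F : ℂ → Matrix (Fin n) γ ℂ} {G : ℂ → Matrix (Fin r) γ' ℂ} {δ : Fin m → ℂ}
    (hN : ∀ ι, MAnalyticAt (N ι) x) (hF : MAnalyticAt F x) (hG : MAnalyticAt G x)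
    (b' : γ' → ℂ) (h : ∀ j ≤ L, mDeriv j F x *ᵥ b = V *ᵥ (mDeriv j G x *ᵥ b')) :
    mDeriv L (fun z => Nsum (fun ι z => Wᴴ * N ι z * V) z δ * G z) x *ᵥ b' =
      Wᴴ *ᵥ (mDeriv L (fun z => Nsum N z δ * F z) x *ᵥ b) := by
  have hS := mAnalyticAt_Nsum hN δ
  simp only [Nsum_projection]
  rw [mDeriv_mul_mulVec (((mAnalyticAt_const _).mul hS).mul (mAnalyticAt_const _)) hG,
    mDeriv_mul_mulVec hS hF, Matrix.mulVec_sum]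
  refine Finset.sum_congr rfl fun i _ => ?_
  rw [h _ (Nat.sub_le _ _), mDeriv_mul_const _ ((mAnalyticAt_const _).mul hS),
    mDeriv_const_mul _ hS, Matrix.mulVec_smul]
  simp only [Matrix.mulVec_mulVec, Matrix.mul_assoc]

/-- The projected Hermite chain is the Hermite chain of the reduced-order system. -/
theorem hChain_projection (ord : ℕ → ℕ) (b : Fin m → ℂ) (t : ℕ)
    (hKa : ∀ j ≤ t, MAnalyticAt K (s j)) (hBa : MAnalyticAt B (s 0))
    (hNa : ∀ j ≤ t, ∀ ι, MAnalyticAt (N ι) (s j)) (hK : ∀ j ≤ t, IsUnit (K (s j)).det)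
    (hKr : ∀ j ≤ t, IsUnit (Wᴴ * K (s j) * V).det)
    (hV : ∀ u ≤ t, ∀ j ≤ ord u, vHerm K B N s d ord b u j ∈ Set.range V.mulVec) :
    hChain (fun z => Wᴴ * K z * V) (fun z => Wᴴ * B z) (fun ι z => Wᴴ * N ι z * V) s d ord t *ᵥ b =
      Wᴴ *ᵥ (hChain K B N s d ord t *ᵥ b) := by
  have hRa : ∀ j ≤ t, MAnalyticAt (fun z => Wᴴ * K z * V) (s j) := fun j hj =>
    ((mAnalyticAt_const _).mul (hKa j hj)).mul (mAnalyticAt_const _)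
  induction t with
  | zero =>
    exact mDeriv_Nsum_mul_projection (hNa 0 le_rfl) (((hKa 0 le_rfl).inv (hK 0 le_rfl)).mul hBa)
      (((hRa 0 le_rfl).inv (hKr 0 le_rfl)).mul ((mAnalyticAt_const _).mul hBa)) b
      fun j hj => mDeriv_inv_mul_mulVec_eq (hKa 0 le_rfl) hBa (hK 0 le_rfl) (hKr 0 le_rfl) b
        (hV 0 le_rfl) hj
  | succ t ih =>
    have hi := (hKa _ le_rfl).inv (hK _ le_rfl)
    have hri := (hRa _ le_rfl).inv (hKr _ le_rfl)
    simp only [hChain]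
    rw [← Matrix.mulVec_mulVec, ← Matrix.mulVec_mulVec,
      ih (fun j hj => hKa j (by lia)) (fun j hj => hNa j (by lia)) (fun j hj => hK j (by lia))
        (fun j hj => hKr j (by lia)) (fun j hj => hV j (by lia)) fun j hj => hRa j (by lia)]
    have key : ∀ j ≤ ord (t + 1),
        mDeriv j (fun z => (K z)⁻¹) (s (t + 1)) *ᵥ (hChain K B N s d ord t *ᵥ b) =
          V *ᵥ (mDeriv j (fun z => (Wᴴ * K z * V)⁻¹) (s (t + 1)) *ᵥ
            (Wᴴ *ᵥ (hChain K B N s d ord t *ᵥ b))) := by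
      intro j hj
      have h := mDeriv_inv_mul_mulVec_eq (U := fun _ => hChain K B N s d ord t) (V := V) (W := W)
        (hKa _ le_rfl) (mAnalyticAt_const _) (hK _ le_rfl) (hKr _ le_rfl) b
        (L := ord (t + 1)) (fun j hj => by
          rw [mDeriv_mul_const _ hi]
          exact hV (t + 1) le_rfl j hj) hj
      rw [mDeriv_mul_const _ hi, mDeriv_mul_const _ hri] at h
      simpa only [Matrix.mulVec_mulVec, Matrix.mul_assoc] using h
    exact mDeriv_Nsum_mul_projection (b := hChain K B N s d ord t *ᵥ b) (δ := d (t + 1))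
      (hNa _ le_rfl) hi hri (Wᴴ *ᵥ (hChain K B N s d ord t *ᵥ b)) key

/-- Left Hermite interpolation vectors in the range of `W` are reproduced by the reduced-order
system. -/
theorem star_wHerm_projection {τ : ℕ → ℂ} {e : ℕ → Fin m → ℂ} {o : ℕ → ℕ} (c : Fin p → ℂ) (t : ℕ)
    (hCa : MAnalyticAt C (τ 0)) (hKa : ∀ j ≤ t, MAnalyticAt K (τ j))
    (hNa : ∀ j ≤ t, ∀ ι, MAnalyticAt (N ι) (τ j)) (hK : ∀ j ≤ t, IsUnit (K (τ j)).det)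
    (hKr : ∀ j ≤ t, IsUnit (Wᴴ * K (τ j) * V).det)
    (hW : ∀ u ≤ t, ∀ j ≤ o u, wHerm C K N τ e o c u j ∈ Set.range W.mulVec)
    {j : ℕ} (hj : j ≤ o t) :
    star (wHerm C K N τ e o c t j) =
      star (wHerm (fun z => C z * V) (fun z => Wᴴ * K z * V) (fun ι z => Wᴴ * N ι z * V)
        τ e o c t j) ᵥ* Wᴴ := by
  have hRa : ∀ j ≤ t, MAnalyticAt (fun z => Wᴴ * K z * V) (τ j) := fun j hj =>
    ((mAnalyticAt_const _).mul (hKa j hj)).mul (mAnalyticAt_const _)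
  have hW' : ∀ u ≤ t, ∀ j ≤ o u, ∃ x, star (wHerm C K N τ e o c u j) = x ᵥ* Wᴴ := by
    intro u hu j hj
    obtain ⟨x, hx⟩ := hW u hu j hj
    exact ⟨star x, by rw [← hx, Matrix.star_mulVec]⟩
  induction t generalizing j with
  | zero =>
    have hi := (hKa _ le_rfl).inv (hK _ le_rfl)
    have hri := (hRa _ le_rfl).inv (hKr _ le_rfl)
    have hw := hW' 0 le_rfl
    simp only [wHerm, star_star] at hw ⊢
    simp only [vDeriv_vecMul _ (hCa.mul hi)] at hw ⊢
    rw [vDeriv_vecMul _ ((hCa.mul (mAnalyticAt_const _)).mul hri)]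
    exact vecMul_mDeriv_mul_inv_eq (hKa _ le_rfl) hCa (hK _ le_rfl) (hKr _ le_rfl) _ hw hj
  | succ t ih =>
    have hi := (hKa _ le_rfl).inv (hK _ le_rfl)
    have hri := (hRa _ le_rfl).inv (hKr _ le_rfl)
    have hS := mAnalyticAt_Nsum (hNa _ le_rfl) (e t)
    have hw := hW' (t + 1) le_rfl
    have h := ih (fun j hj => hKa j (by lia)) (fun j hj => hNa j (by lia))
      (fun j hj => hK j (by lia)) (fun j hj => hKr j (by lia)) (fun j hj => hW j (by lia))
      (le_refl (o t)) (fun j hj => hRa j (by lia)) (fun j hj => hW' j (by lia))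
    simp only [wHerm, star_star, Nsum_projection] at hw ⊢
    simp only [vDeriv_vecMul _ (hS.mul hi)] at hw ⊢
    rw [vDeriv_vecMul _ ((((mAnalyticAt_const _).mul hS).mul (mAnalyticAt_const _)).mul hri),
      vecMul_mDeriv_mul_inv_eq (hKa _ le_rfl) hS (hK _ le_rfl) (hKr _ le_rfl) _ hw hj, h]
    simp only [Matrix.mul_assoc]
    rw [mDeriv_const_mul _ (hS.mul ((mAnalyticAt_const _).mul
      (by simpa only [Matrix.mul_assoc] using hri)))]
    simp only [Matrix.vecMul_vecMul, Matrix.mul_assoc]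

end Reduction

end System

theorem stmt_5 {n m p r : ℕ} (hn : 0 < n) (hm : 0 < m) (hp : 0 < p) (hr : 0 < r)
    (C : ℂ → Matrix (Fin p) (Fin n) ℂ) (K : ℂ → Matrix (Fin n) (Fin n) ℂ)
    (B : ℂ → Matrix (Fin n) (Fin m) ℂ) (N : Fin m → ℂ → Matrix (Fin n) (Fin n) ℂ)
    (V W : Matrix (Fin n) (Fin r) ℂ)
    (k κ : ℕ) (hk : 0 < k) (hκ : 0 < κ) (σ ς : ℕ → ℂ) (d δ : ℕ → Fin m → ℂ)
    (ℓ ν : ℕ → ℕ) (b : Fin m → ℂ) (c : Fin p → ℂ)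
    (hCa : ∀ j < k, ∀ a e, AnalyticAt ℂ (fun z => C z a e) (σ j))
    (hKa : ∀ j < k, ∀ a e, AnalyticAt ℂ (fun z => K z a e) (σ j))
    (hBa : ∀ j < k, ∀ a e, AnalyticAt ℂ (fun z => B z a e) (σ j))
    (hNa : ∀ j < k, ∀ ι a e, AnalyticAt ℂ (fun z => N ι z a e) (σ j))
    (hCa' : ∀ i < κ, ∀ a e, AnalyticAt ℂ (fun z => C z a e) (ς i))
    (hKa' : ∀ i < κ, ∀ a e, AnalyticAt ℂ (fun z => K z a e) (ς i))
    (hBa' : ∀ i < κ, ∀ a e, AnalyticAt ℂ (fun z => B z a e) (ς i))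
    (hNa' : ∀ i < κ, ∀ ι a e, AnalyticAt ℂ (fun z => N ι z a e) (ς i))
    (hK : ∀ j < k, IsUnit (K (σ j)).det)
    (hK' : ∀ i < κ, IsUnit (K (ς i)).det)
    (hKr : ∀ j < k, IsUnit (Wᴴ * K (σ j) * V).det)
    (hKr' : ∀ i < κ, IsUnit (Wᴴ * K (ς i) * V).det)
    (hV : ∀ t < k, ∀ j ≤ ℓ t, vHerm K B N σ d ℓ b t j ∈ Set.range V.mulVec)
    (hW : ∀ t < κ, ∀ j ≤ ν (κ - 1 - t),
      wHerm C K N (fun t => ς (κ - 1 - t)) (fun t => δ (κ - 2 - t))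
          (fun t => ν (κ - 1 - t)) c t j ∈ Set.range W.mulVec) :
    ∀ q < k, ∀ η < κ, ∀ z : Fin m → ℂ, ∀ jq ≤ ℓ q, ∀ i ≤ ν (κ - 1 - η),
      star c ⬝ᵥ
          ((Matrix.of fun a e =>
            mixedD
              (fun t =>
                if t < q then ℓ t
                else if t = q then jq
                else if t = q + 1 then i
                else ν (κ - 1 - η + (t - (q + 1)))) (q + η + 2)
              (fun s =>
                Gmod C K B N s
                  (fun j =>
                    if j < q then d j
                    else if j = q then z
                    else δ (κ - 1 - η + (j - (q + 1)))) (q + η + 1) a e)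
              (fun j => if j ≤ q then σ j else ς (κ - 1 - η + (j - (q + 1))))) *ᵥ b) =
        star c ⬝ᵥ
          ((Matrix.of fun a e =>
            mixedD
              (fun t =>
                if t < q then ℓ t
                else if t = q then jq
                else if t = q + 1 then i
                else ν (κ - 1 - η + (t - (q + 1)))) (q + η + 2)
              (fun s =>
                Gmod (fun s => C s * V) (fun s => Wᴴ * K s * V) (fun s => Wᴴ * B s) (fun ι s => Wᴴ * N ι s * V) s
                  (fun j =>
                    if j < q then d j
                    else if j = q then z
                    else δ (κ - 1 - η + (j - (q + 1)))) (q + η + 1) a e)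
              (fun j => if j ≤ q then σ j else ς (κ - 1 - η + (j - (q + 1))))) *ᵥ b) := by
  intro q hq η hη z jq hjq i hi
  set ord : ℕ → ℕ := fun t =>
    if t < q then ℓ t
    else if t = q then jq
    else if t = q + 1 then i
    else ν (κ - 1 - η + (t - (q + 1))) with hord
  set D : ℕ → Fin m → ℂ := fun j =>
    if j < q then d j
    else if j = q then z
    else δ (κ - 1 - η + (j - (q + 1))) with hD
  set s : ℕ → ℂ := fun j => if j ≤ q then σ j else ς (κ - 1 - η + (j - (q + 1))) with hs
  have hs_le : ∀ j ≤ q, s j = σ j := fun j hj => if_pos hj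
  have hs_rev : ∀ j ≤ η, s (q + η + 1 - j) = ς (κ - 1 - j) := by
    intro j hj
    simp only [hs]
    rw [if_neg (by lia)]
    congr 1
    lia
  have hD_rev : ∀ j < η, D (q + η - j) = δ (κ - 2 - j) := by
    intro j hj
    simp only [hD]
    rw [if_neg (by lia), if_neg (by lia)]
    congr 1
    lia
  have hord_rev : ∀ j < η, ord (q + η + 1 - j) = ν (κ - 1 - j) := by
    intro j hj
    simp only [hord]
    rw [if_neg (by lia), if_neg (by lia), if_neg (by lia)]
    congr 1
    lia
  have hord_i : ord (q + η + 1 - η) = i := by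
    simp only [hord]
    rw [if_neg (by lia), if_neg (by lia), if_pos (by lia)]
  have hord_le : ∀ u ≤ q, ord u ≤ ℓ u := by
    intro u hu
    simp only [hord]
    rcases hu.lt_or_eq with h | rfl
    · rw [if_pos h]
    · rwa [if_neg (lt_irrefl _), if_pos rfl]
  have hpt : ∀ P : ℂ → Prop, (∀ j < k, P (σ j)) → (∀ j < κ, P (ς j)) →
      ∀ j ≤ q + η + 1, P (s j) := by
    intro P h h' j hj
    simp only [hs]
    split_ifs
    · exact h _ (by lia)
    · exact h' _ (by lia)
  have hCs := hpt (MAnalyticAt C) hCa hCa'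
  have hKs := hpt (MAnalyticAt K) hKa hKa'
  have hBs := hpt (MAnalyticAt B) hBa hBa'
  have hNs := hpt (fun x => ∀ ι, MAnalyticAt (N ι) x) hNa hNa'
  have hKu := hpt (fun x => IsUnit (K x).det) hK hK'
  have hRu := hpt (fun x => IsUnit (Wᴴ * K x * V).det) hKr hKr'
  have hCr : ∀ j ≤ q + η + 1, MAnalyticAt (fun x => C x * V) (s j) := fun j hj =>
    (hCs j hj).mul (mAnalyticAt_const _)
  have hRs : ∀ j ≤ q + η + 1, MAnalyticAt (fun x => Wᴴ * K x * V) (s j) := fun j hj =>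
    ((mAnalyticAt_const _).mul (hKs j hj)).mul (mAnalyticAt_const _)
  have hBr : ∀ j ≤ q + η + 1, MAnalyticAt (fun x => Wᴴ * B x) (s j) := fun j hj =>
    (mAnalyticAt_const _).mul (hBs j hj)
  have hNr : ∀ j ≤ q + η + 1, ∀ ι, MAnalyticAt (fun x => Wᴴ * N ι x * V) (s j) := fun j hj ι =>
    ((mAnalyticAt_const _).mul (hNs j hj ι)).mul (mAnalyticAt_const _)
  have hη' : η ≤ q + η := Nat.le_add_left _ _
  rw [mixedD_Gmod ord (q + η) (hCs _ le_rfl) hKs (hBs 0 (by lia)) (fun j hj => hNs j (by lia)) hKu,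
    mixedD_Gmod (N := fun ι x => Wᴴ * N ι x * V) ord (q + η) (hCr _ le_rfl) hRs (hBr 0 (by lia))
      (fun j hj => hNr j (by lia)) hRu,
    star_dotProduct_mDeriv_mul_hChain ord (q + η) b c (hCs _ le_rfl) hKs
      (fun j hj => hNs j (by lia)) hKu hη',
    star_dotProduct_mDeriv_mul_hChain (N := fun ι x => Wᴴ * N ι x * V) ord (q + η) b c
      (hCr _ le_rfl) hRs (fun j hj => hNr j (by lia)) hRu hη', Nat.add_sub_cancel]
  rw [hChain_projection ord b q (fun j hj => hKs j (by lia)) (hBs 0 (by lia))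
      (fun j hj => hNs j (by lia)) (fun j hj => hKu j (by lia)) (fun j hj => hRu j (by lia))
      fun u hu j hj => by
        rw [vHerm_congr (fun j hj => hs_le j (by lia)) (fun j hj => if_pos (by lia))
          fun j hj => if_pos (by lia)]
        exact hV u (by lia) j (hj.trans (hord_le u hu)),
    Matrix.dotProduct_mulVec _ Wᴴ,
    ← star_wHerm_projection (τ := fun j => s (q + η + 1 - j)) (e := fun j => D (q + η - j))
      (o := fun j => ord (q + η + 1 - j)) c η (hCs _ le_rfl) (fun j hj => hKs _ (by lia))
      (fun j hj => hNs _ (by lia)) (fun j hj => hKu _ (by lia)) (fun j hj => hRu _ (by lia))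
      (fun u hu j hj => by
        rw [wHerm_congr (fun j hj => hs_rev j (by lia)) (fun j hj => hD_rev j (by lia))
          fun j hj => hord_rev j (by lia)]
        refine hW u (by lia) j (hj.trans ?_)
        rcases hu.lt_or_eq with h | rfl
        · exact (hord_rev u h).le
        · exact hord_i.trans_le hi) le_rfl]

end StructBilin
end

section
/- Suppose C, K, B, and all N_j are analytic at σ_1,…,σ_k ∈ ℂ and that K(σ_i) and K̂(σ_i) = Wᴴ K(σ_i) V are invertible for all i = 1,…,k. Let b ∈ ℂ^m, c ∈ ℂ^p, and d^{(1)},…,d^{(k-1)} ∈ ℂ^m. Let the column space of V contain v_1 = K(σ_1)^{-1} B(σ_1) b and v_j = K(σ_j)^{-1} 𝔑(σ_{j-1}, d^{(j-1)}) v_{j-1} for 2 ≤ j ≤ k, and let the column space of W contain w_1 = K(σ_k)^{-ᴴ} C(σ_k)ᴴ c and w_i = K(σ_{k-i+1})^{-ᴴ} 𝔑(σ_{k-i+1}, d^{(k-i+1)})ᴴ w_{i-1} for 2 ≤ i ≤ k (i.e., V and W are built with identical interpolation points and scaling vectors). Then all first-order partial derivatives of the scalar-valued function (s_1,…,s_k,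 d^{(1)},…,d^{(k-1)}) ↦ cᴴ 𝔾_k(s_1,…,s_k | d^{(1)},…,d^{(k-1)}) b — with respect to each frequency variable s_i (1 ≤ i ≤ k) and with respect to each component d^{(j)}_i of each scaling vector (1 ≤ j ≤ k-1, 1 ≤ i ≤ m) — coincide with those of (s_1,…,s_k, d^{(1)},…,d^{(k-1)}) ↦ cᴴ 𝔾̂_k(s_1,…,s_k | d^{(1)},…,d^{(k-1)}) b when evaluated at (σ_1,…,σ_k, d^{(1)},…,d^{(k-1)}). -/
open Matrix
open scoped Kronecker

namespace StructBilin

section Projection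

variable {n r : ℕ}

/-- Petrov–Galerkin projection reproduces solutions lying in the column space of `V`. -/
theorem galerkin_mulVec (M : Matrix (Fin n) (Fin n) ℂ) (V W : Matrix (Fin n) (Fin r) ℂ)
    (hM : IsUnit M.det) (hG : IsUnit (Wᴴ * M * V).det) (R : Fin n → ℂ)
    (hx : M⁻¹ *ᵥ R ∈ Set.range V.mulVec) :
    V *ᵥ ((Wᴴ * M * V)⁻¹ *ᵥ (Wᴴ *ᵥ R)) = M⁻¹ *ᵥ R := by
  obtain ⟨x, hx⟩ := hx
  have hR : R = M *ᵥ (V *ᵥ x) := by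
    rw [hx, mulVec_mulVec, mul_nonsing_inv _ hM, one_mulVec]
  have h : Wᴴ *ᵥ R = (Wᴴ * M * V) *ᵥ x := by
    rw [hR, mulVec_mulVec, mulVec_mulVec, Matrix.mul_assoc]
  rw [h, mulVec_mulVec x (Wᴴ * M * V)⁻¹, nonsing_inv_mul _ hG, one_mulVec, hx]

/-- Petrov–Galerkin projection reproduces adjoint solutions lying in the column space of `W`. -/
theorem galerkin_vecMul (M : Matrix (Fin n) (Fin n) ℂ) (V W : Matrix (Fin n) (Fin r) ℂ)
    (hM : IsUnit M.det) (hG : IsUnit (Wᴴ * M * V).det) (L : Fin n → ℂ)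
    (hy : star (L ᵥ* M⁻¹) ∈ Set.range W.mulVec) :
    ((L ᵥ* V) ᵥ* (Wᴴ * M * V)⁻¹) ᵥ* Wᴴ = L ᵥ* M⁻¹ := by
  obtain ⟨y, hy⟩ := hy
  have hy' : star y ᵥ* Wᴴ = L ᵥ* M⁻¹ := by
    rw [← star_mulVec, hy, star_star]
  have hL : L = (star y ᵥ* Wᴴ) ᵥ* M := by
    rw [hy', vecMul_vecMul, nonsing_inv_mul _ hM, vecMul_one]
  have h : L ᵥ* V = star y ᵥ* (Wᴴ * M * V) := by
    rw [hL, vecMul_vecMul, vecMul_vecMul, Matrix.mul_assoc]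
  rw [h, vecMul_vecMul (star y) _ (Wᴴ * M * V)⁻¹, mul_nonsing_inv _ hG, vecMul_one, hy']

/-- The difference of a resolvent and its Petrov–Galerkin approximation factors quadratically. -/
theorem galerkin_error_factor (M : Matrix (Fin n) (Fin n) ℂ) (V W : Matrix (Fin n) (Fin r) ℂ)
    (hM : IsUnit M.det) (hG : IsUnit (Wᴴ * M * V).det) :
    (M⁻¹ - V * (Wᴴ * M * V)⁻¹ * Wᴴ) * M * (M⁻¹ - V * (Wᴴ * M * V)⁻¹ * Wᴴ) =
      M⁻¹ - V * (Wᴴ * M * V)⁻¹ * Wᴴ := by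
  have h : V * (Wᴴ * M * V)⁻¹ * Wᴴ * M * (V * (Wᴴ * M * V)⁻¹ * Wᴴ) =
      V * (Wᴴ * M * V)⁻¹ * Wᴴ := by
    calc _ = V * ((Wᴴ * M * V)⁻¹ * (Wᴴ * M * V)) * (Wᴴ * M * V)⁻¹ * Wᴴ := by
          simp only [Matrix.mul_assoc]
      _ = _ := by rw [nonsing_inv_mul _ hG, Matrix.mul_one]
  rw [Matrix.sub_mul, nonsing_inv_mul _ hM, Matrix.sub_mul, Matrix.one_mul, Matrix.mul_sub, h,
    Matrix.mul_assoc _ M M⁻¹, mul_nonsing_inv _ hM, Matrix.mul_one, sub_self, sub_zero]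

end Projection

section Differentiability

variable {α β γ : Type*} [Fintype β]

theorem differentiableAt_matrix_mul {f : ℂ → Matrix α β ℂ} {g : ℂ → Matrix β γ ℂ} {z : ℂ}
    (hf : ∀ a e, DifferentiableAt ℂ (fun z => f z a e) z)
    (hg : ∀ a e, DifferentiableAt ℂ (fun z => g z a e) z) (a : α) (e : γ) :
    DifferentiableAt ℂ (fun z => (f z * g z) a e) z := by
  simp only [Matrix.mul_apply]
  exact DifferentiableAt.fun_sum fun i _ => (hf a i).mul (hg i e)

theorem differentiableAt_matrix_mulVec {f : ℂ → Matrix α β ℂ} {g : ℂ → β → ℂ} {z : ℂ}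
    (hf : ∀ a e, DifferentiableAt ℂ (fun z => f z a e) z)
    (hg : ∀ a, DifferentiableAt ℂ (fun z => g z a) z) (a : α) :
    DifferentiableAt ℂ (fun z => (f z *ᵥ g z) a) z := by
  simp only [Matrix.mulVec, dotProduct]
  exact DifferentiableAt.fun_sum fun i _ => (hf a i).mul (hg i)

theorem differentiableAt_vecMul {f : ℂ → Matrix β γ ℂ} {g : ℂ → β → ℂ} {z : ℂ}
    (hf : ∀ a e, DifferentiableAt ℂ (fun z => f z a e) z)
    (hg : ∀ a, DifferentiableAt ℂ (fun z => g z a) z) (e : γ) :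
    DifferentiableAt ℂ (fun z => (g z ᵥ* f z) e) z := by
  simp only [Matrix.vecMul, dotProduct]
  exact DifferentiableAt.fun_sum fun i _ => (hg i).mul (hf i e)

theorem differentiableAt_dotProduct {f g : ℂ → β → ℂ} {z : ℂ}
    (hf : ∀ a, DifferentiableAt ℂ (fun z => f z a) z)
    (hg : ∀ a, DifferentiableAt ℂ (fun z => g z a) z) :
    DifferentiableAt ℂ (fun z => f z ⬝ᵥ g z) z := by
  simp only [dotProduct]
  exact DifferentiableAt.fun_sum fun i _ => (hf i).mul (hg i)

variable [DecidableEq β]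

theorem differentiableAt_matrix_det {f : ℂ → Matrix β β ℂ} {z : ℂ}
    (hf : ∀ a e, DifferentiableAt ℂ (fun z => f z a e) z) :
    DifferentiableAt ℂ (fun z => (f z).det) z := by
  simp only [Matrix.det_apply']
  exact DifferentiableAt.fun_sum fun τ _ => (differentiableAt_const _).mul
    (DifferentiableAt.fun_finsetProd fun i _ => hf _ _)

theorem differentiableAt_matrix_inv {f : ℂ → Matrix β β ℂ} {z : ℂ}
    (hf : ∀ a e, DifferentiableAt ℂ (fun z => f z a e) z) (hz : IsUnit (f z).det) (a e : β) :
    DifferentiableAt ℂ (fun z => (f z)⁻¹ a e) z := by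
  simp only [Matrix.inv_def, Matrix.smul_apply, Ring.inverse_eq_inv, Matrix.adjugate_apply]
  refine ((differentiableAt_matrix_det hf).inv hz.ne_zero).smul
    (differentiableAt_matrix_det fun i l => ?_)
  by_cases h : i = e
  · subst h
    simp
  · simpa [Matrix.updateRow_ne h] using hf i l

end Differentiability

/-- A resolvent form and its Petrov–Galerkin approximation have equal derivatives at a point
where both the solution and the adjoint solution lie in the projection spaces. -/
theorem deriv_galerkin {n r : ℕ} (V W : Matrix (Fin n) (Fin r) ℂ) {L R : ℂ → Fin n → ℂ}
    {K : ℂ → Matrix (Fin n) (Fin n) ℂ} {z₀ : ℂ}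
    (hL : ∀ a, DifferentiableAt ℂ (fun z => L z a) z₀)
    (hR : ∀ a, DifferentiableAt ℂ (fun z => R z a) z₀)
    (hKd : ∀ a e, DifferentiableAt ℂ (fun z => K z a e) z₀)
    (hK : IsUnit (K z₀).det) (hG : IsUnit (Wᴴ * K z₀ * V).det)
    (hx : (K z₀)⁻¹ *ᵥ R z₀ ∈ Set.range V.mulVec)
    (hy : star (L z₀ ᵥ* (K z₀)⁻¹) ∈ Set.range W.mulVec) :
    deriv (fun z => L z ⬝ᵥ ((K z)⁻¹ *ᵥ R z)) z₀ =
      deriv (fun z => (L z ᵥ* V) ⬝ᵥ ((Wᴴ * K z * V)⁻¹ *ᵥ (Wᴴ *ᵥ R z))) z₀ := by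
  have hGd : ∀ a e, DifferentiableAt ℂ (fun z => (Wᴴ * K z * V) a e) z₀ :=
    differentiableAt_matrix_mul (differentiableAt_matrix_mul (by simp) hKd) (by simp)
  have hKi := differentiableAt_matrix_inv hKd hK
  have hGi := differentiableAt_matrix_inv hGd hG
  set E : ℂ → Matrix (Fin n) (Fin n) ℂ :=
    fun z => (K z)⁻¹ - V * (Wᴴ * K z * V)⁻¹ * Wᴴ with hE
  have hEd : ∀ a e, DifferentiableAt ℂ (fun z => E z a e) z₀ := fun a e =>
    (hKi a e).sub (differentiableAt_matrix_mul (f := fun z => V * (Wᴴ * K z * V)⁻¹)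
      (g := fun _ => Wᴴ) (differentiableAt_matrix_mul (by simp) hGi) (by simp) a e)
  have hl : L z₀ ᵥ* E z₀ = 0 := by
    rw [hE, vecMul_sub, ← vecMul_vecMul, ← vecMul_vecMul, galerkin_vecMul _ V W hK hG _ hy,
      sub_self]
  have hr : E z₀ *ᵥ R z₀ = 0 := by
    rw [hE, sub_mulVec, ← mulVec_mulVec, ← mulVec_mulVec, galerkin_mulVec _ V W hK hG _ hx,
      sub_self]
  have hf₁ : DifferentiableAt ℂ (fun z => L z ⬝ᵥ ((K z)⁻¹ *ᵥ R z)) z₀ :=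
    differentiableAt_dotProduct hL (differentiableAt_matrix_mulVec hKi hR)
  have hf₂ : DifferentiableAt ℂ
      (fun z => (L z ᵥ* V) ⬝ᵥ ((Wᴴ * K z * V)⁻¹ *ᵥ (Wᴴ *ᵥ R z))) z₀ :=
    differentiableAt_dotProduct (differentiableAt_vecMul (by simp) hL)
      (differentiableAt_matrix_mulVec hGi (differentiableAt_matrix_mulVec (by simp) hR))
  have hev : (fun z => L z ⬝ᵥ ((K z)⁻¹ *ᵥ R z) -
      (L z ᵥ* V) ⬝ᵥ ((Wᴴ * K z * V)⁻¹ *ᵥ (Wᴴ *ᵥ R z))) =ᶠ[nhds z₀]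
      fun z => ∑ a, (L z ᵥ* E z) a * (K z *ᵥ (E z *ᵥ R z)) a := by
    filter_upwards [(differentiableAt_matrix_det hKd).continuousAt.eventually_ne hK.ne_zero,
      (differentiableAt_matrix_det hGd).continuousAt.eventually_ne hG.ne_zero] with z h₁ h₂
    have h : E z * K z * E z = E z := galerkin_error_factor (K z) V W h₁.isUnit h₂.isUnit
    change _ = (L z ᵥ* E z) ⬝ᵥ (K z *ᵥ (E z *ᵥ R z))
    have h₃ : (L z ᵥ* E z) ⬝ᵥ (K z *ᵥ (E z *ᵥ R z)) = L z ⬝ᵥ (E z *ᵥ R z) := by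
      rw [← dotProduct_mulVec, mulVec_mulVec, mulVec_mulVec, h]
    rw [h₃, hE, sub_mulVec, dotProduct_sub, ← dotProduct_mulVec, mulVec_mulVec, mulVec_mulVec,
      Matrix.mul_assoc]
  have hzero : HasDerivAt (fun z => ∑ a, (L z ᵥ* E z) a * (K z *ᵥ (E z *ᵥ R z)) a) 0 z₀ := by
    have h := HasDerivAt.fun_sum (u := Finset.univ) fun a (_ : a ∈ Finset.univ) =>
      (differentiableAt_vecMul hEd hL a).hasDerivAt.mul
        (differentiableAt_matrix_mulVec hKd
          (differentiableAt_matrix_mulVec hEd hR) a).hasDerivAt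
    simpa [hl, hr] using h
  have h := (hzero.congr_of_eventuallyEq hev).deriv
  rw [deriv_fun_sub hf₁ hf₂] at h
  exact sub_eq_zero.mp h

section Chains

variable {n m p : ℕ} (C : ℂ → Matrix (Fin p) (Fin n) ℂ) (K : ℂ → Matrix (Fin n) (Fin n) ℂ)
  (B : ℂ → Matrix (Fin n) (Fin m) ℂ) (N : Fin m → ℂ → Matrix (Fin n) (Fin n) ℂ)

/-- The right-hand side of the linear system `K(σ j) v j = rhs` defining `vtan`, with the last
frequency made explicit. -/
noncomputable def rightSource (σ : ℕ → ℂ) (d : ℕ → Fin m → ℂ) (b : Fin m → ℂ) (z : ℂ) :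
    ℕ → Fin n → ℂ
  | 0 => B z *ᵥ b
  | j + 1 => Nsum N (σ j) (d j) *ᵥ vtan K B N σ d b j

/-- The row vector `ℓ` with `(w t)ᴴ K(τ t) = ℓ` for `w = wtan`, with the last frequency made
explicit. -/
noncomputable def leftSource (τ : ℕ → ℂ) (e : ℕ → Fin m → ℂ) (c : Fin p → ℂ) (z : ℂ) :
    ℕ → Fin n → ℂ
  | 0 => star c ᵥ* C z
  | t + 1 => star (wtan C K N τ e c t) ᵥ* Nsum N z (e t)

theorem vtan_eq (σ : ℕ → ℂ) (d : ℕ → Fin m → ℂ) (b : Fin m → ℂ) (j : ℕ) :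
    vtan K B N σ d b j = (K (σ j))⁻¹ *ᵥ rightSource K B N σ d b (σ j) j := by
  cases j <;> rfl

theorem star_wtan_eq (τ : ℕ → ℂ) (e : ℕ → Fin m → ℂ) (c : Fin p → ℂ) (t : ℕ) :
    star (wtan C K N τ e c t) = leftSource C K N τ e c (τ t) t ᵥ* (K (τ t))⁻¹ := by
  cases t <;> simp [wtan, leftSource, star_mulVec]

theorem gAux_mulVec (σ : ℕ → ℂ) (d : ℕ → Fin m → ℂ) (b : Fin m → ℂ) (j : ℕ) :
    gAux K B N σ d j *ᵥ b = vtan K B N σ d b j := by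
  induction j with
  | zero => simp [gAux, vtan]
  | succ j ih => simp [gAux, vtan, ← ih, Matrix.mul_assoc]

theorem vtan_congr {σ σ' : ℕ → ℂ} {d d' : ℕ → Fin m → ℂ} (b : Fin m → ℂ) {j : ℕ}
    (hσ : ∀ i ≤ j, σ i = σ' i) (hd : ∀ i < j, d i = d' i) :
    vtan K B N σ d b j = vtan K B N σ' d' b j := by
  induction j with
  | zero => simp [vtan, hσ]
  | succ j ih =>
    simp only [vtan]
    rw [hσ _ le_rfl, hσ j (by omega), hd j (by omega),
      ih (fun i hi => hσ i (by omega)) fun i hi => hd i (by omega)]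

theorem wtan_congr {τ τ' : ℕ → ℂ} {e e' : ℕ → Fin m → ℂ} (c : Fin p → ℂ) {t : ℕ}
    (hτ : ∀ i ≤ t, τ i = τ' i) (he : ∀ i < t, e i = e' i) :
    wtan C K N τ e c t = wtan C K N τ' e' c t := by
  induction t with
  | zero => simp [wtan, hτ]
  | succ t ih =>
    simp only [wtan]
    rw [hτ _ le_rfl, he t (by omega),
      ih (fun i hi => hτ i (by omega)) fun i hi => he i (by omega)]

theorem rightSource_congr {σ σ' : ℕ → ℂ} {d d' : ℕ → Fin m → ℂ} (b : Fin m → ℂ) (z : ℂ) {j : ℕ}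
    (hσ : ∀ i < j, σ i = σ' i) (hd : ∀ i < j, d i = d' i) :
    rightSource K B N σ d b z j = rightSource K B N σ' d' b z j := by
  cases j with
  | zero => rfl
  | succ j =>
    simp only [rightSource]
    rw [hσ j (by omega), hd j (by omega), vtan_congr K B N b (fun i hi => hσ i (by omega))
      fun i hi => hd i (by omega)]

theorem leftSource_congr {τ τ' : ℕ → ℂ} {e e' : ℕ → Fin m → ℂ} (c : Fin p → ℂ) (z : ℂ) {t : ℕ}
    (hτ : ∀ i < t, τ i = τ' i) (he : ∀ i < t, e i = e' i) :
    leftSource C K N τ e c z t = leftSource C K N τ' e' c z t := by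
  cases t with
  | zero => rfl
  | succ t =>
    simp only [leftSource]
    rw [he t (by omega), wtan_congr C K N c (fun i hi => hτ i (by omega))
      fun i hi => he i (by omega)]

/-- The tangential transfer function value, cut at position `j`. -/
theorem dotProduct_Gmod_mulVec (s : ℕ → ℂ) (d : ℕ → Fin m → ℂ) (b : Fin m → ℂ) (c : Fin p → ℂ)
    {q j t : ℕ} (h : j + t = q) :
    star c ⬝ᵥ (Gmod C K B N s d q *ᵥ b) =
      leftSource C K N (fun t => s (q - t)) (fun t => d (q - 1 - t)) c (s j) t ⬝ᵥ
        vtan K B N s d b j := by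
  induction t generalizing j with
  | zero =>
    subst h
    rw [Gmod, ← mulVec_mulVec, gAux_mulVec, dotProduct_mulVec]
    rfl
  | succ t ih =>
    have h₁ : q - t = j + 1 := by omega
    have h₂ : q - 1 - t = j := by omega
    rw [ih (j := j + 1) (by omega)]
    rw [leftSource, star_wtan_eq, vtan]
    simp only [h₁, h₂, dotProduct_mulVec, vecMul_vecMul]

theorem Nsum_projected {r : ℕ} (V W : Matrix (Fin n) (Fin r) ℂ) (s : ℂ) (d : Fin m → ℂ) :
    Nsum (fun ι s => Wᴴ * N ι s * V) s d = Wᴴ * Nsum N s d * V := by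
  simp [Nsum, Matrix.mul_sum, Matrix.sum_mul]

theorem differentiableAt_Nsum {z₀ : ℂ} (d : Fin m → ℂ)
    (h : ∀ ι a e, DifferentiableAt ℂ (fun z => N ι z a e) z₀) (a e : Fin n) :
    DifferentiableAt ℂ (fun z => Nsum N z d a e) z₀ := by
  simp only [Nsum, Matrix.sum_apply, Matrix.smul_apply]
  exact DifferentiableAt.fun_sum fun ι _ => (h ι a e).const_smul (d ι)

section Reduced

variable {r : ℕ} (V W : Matrix (Fin n) (Fin r) ℂ)

theorem rightSource_projected {σ : ℕ → ℂ} {d : ℕ → Fin m → ℂ} {b : Fin m → ℂ} {j : ℕ}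
    (h : ∀ i < j, V *ᵥ vtan (fun s => Wᴴ * K s * V) (fun s => Wᴴ * B s)
      (fun ι s => Wᴴ * N ι s * V) σ d b i = vtan K B N σ d b i) (z : ℂ) :
    rightSource (fun s => Wᴴ * K s * V) (fun s => Wᴴ * B s) (fun ι s => Wᴴ * N ι s * V) σ d b z j =
      Wᴴ *ᵥ rightSource K B N σ d b z j := by
  cases j with
  | zero => simp [rightSource]
  | succ j =>
    simp only [rightSource]
    rw [← h j (by omega), Nsum_projected]
    simp only [mulVec_mulVec, Matrix.mul_assoc]

theorem leftSource_projected {τ : ℕ → ℂ} {e : ℕ → Fin m → ℂ} {c : Fin p → ℂ} {t : ℕ}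
    (h : ∀ i < t, star (wtan (fun s => C s * V) (fun s => Wᴴ * K s * V)
      (fun ι s => Wᴴ * N ι s * V) τ e c i) ᵥ* Wᴴ = star (wtan C K N τ e c i)) (z : ℂ) :
    leftSource (fun s => C s * V) (fun s => Wᴴ * K s * V) (fun ι s => Wᴴ * N ι s * V) τ e c z t =
      leftSource C K N τ e c z t ᵥ* V := by
  cases t with
  | zero => simp [leftSource]
  | succ t =>
    simp only [leftSource]
    rw [← h t (by omega), Nsum_projected]
    simp only [vecMul_vecMul, Matrix.mul_assoc]

theorem mulVec_vtan_projected {σ : ℕ → ℂ} {d : ℕ → Fin m → ℂ} {b : Fin m → ℂ} {k : ℕ}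
    (hK : ∀ j < k, IsUnit (K (σ j)).det) (hKr : ∀ j < k, IsUnit (Wᴴ * K (σ j) * V).det)
    (hV : ∀ j < k, vtan K B N σ d b j ∈ Set.range V.mulVec) (j : ℕ) (hj : j < k) :
    V *ᵥ vtan (fun s => Wᴴ * K s * V) (fun s => Wᴴ * B s) (fun ι s => Wᴴ * N ι s * V) σ d b j =
      vtan K B N σ d b j := by
  induction j using Nat.strong_induction_on with
  | _ j ih =>
    have hv := hV j hj
    rw [vtan_eq] at hv
    rw [vtan_eq, rightSource_projected K B N V W fun i hi => ih i hi (by omega),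
      galerkin_mulVec _ V W (hK j hj) (hKr j hj) _ hv, ← vtan_eq]

theorem star_wtan_projected_vecMul {τ : ℕ → ℂ} {e : ℕ → Fin m → ℂ} {c : Fin p → ℂ} {k : ℕ}
    (hK : ∀ t < k, IsUnit (K (τ t)).det) (hKr : ∀ t < k, IsUnit (Wᴴ * K (τ t) * V).det)
    (hW : ∀ t < k, wtan C K N τ e c t ∈ Set.range W.mulVec) (t : ℕ) (ht : t < k) :
    star (wtan (fun s => C s * V) (fun s => Wᴴ * K s * V) (fun ι s => Wᴴ * N ι s * V)
      τ e c t) ᵥ* Wᴴ = star (wtan C K N τ e c t) := by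
  induction t using Nat.strong_induction_on with
  | _ t ih =>
    have hw := hW t ht
    rw [← star_star (wtan C K N τ e c t), star_wtan_eq] at hw
    rw [star_wtan_eq, leftSource_projected C K N V W fun i hi => ih i hi (by omega),
      galerkin_vecMul _ V W (hK t ht) (hKr t ht) _ hw, ← star_wtan_eq]

end Reduced

/-- The tangential transfer function as a function of its `i`-th frequency. -/
theorem dotProduct_Gmod_update_mulVec (σ : ℕ → ℂ) (d : ℕ → Fin m → ℂ) (b : Fin m → ℂ)
    (c : Fin p → ℂ) {q i t : ℕ} (h : i + t = q) (z : ℂ) :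
    star c ⬝ᵥ (Gmod C K B N (Function.update σ i z) d q *ᵥ b) =
      leftSource C K N (fun t => σ (q - t)) (fun t => d (q - 1 - t)) c z t ⬝ᵥ
        ((K z)⁻¹ *ᵥ rightSource K B N σ d b z i) := by
  rw [dotProduct_Gmod_mulVec C K B N _ d b c h, vtan_eq, Function.update_self,
    leftSource_congr C K N c z (τ' := fun t => σ (q - t)) (e' := fun t => d (q - 1 - t))
      (fun l hl => Function.update_of_ne (by omega) _ _) (fun _ _ => rfl),
    rightSource_congr K B N b z (σ' := σ) (d' := d)
      (fun l hl => Function.update_of_ne (by omega) _ _) (fun _ _ => rfl)]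

/-- The tangential transfer function as a function of its `j`-th scaling vector. -/
theorem dotProduct_Gmod_update_scaling_mulVec (σ : ℕ → ℂ) (d : ℕ → Fin m → ℂ) (b : Fin m → ℂ)
    (c : Fin p → ℂ) {q j t : ℕ} (h : j + (t + 1) = q) (x : Fin m → ℂ) :
    star c ⬝ᵥ (Gmod C K B N σ (Function.update d j x) q *ᵥ b) =
      star (wtan C K N (fun t => σ (q - t)) (fun t => d (q - 1 - t)) c t) ⬝ᵥ
        (Nsum N (σ j) x *ᵥ vtan K B N σ d b j) := by
  have hj : q - 1 - t = j := by omega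
  rw [dotProduct_Gmod_mulVec C K B N σ _ b c h, leftSource, hj, Function.update_self,
    wtan_congr C K N c (τ' := fun t => σ (q - t)) (e' := fun t => d (q - 1 - t))
      (fun _ _ => rfl) (fun l hl => Function.update_of_ne (by omega) _ _),
    vtan_congr K B N b (σ' := σ) (d' := d)
      (fun _ _ => rfl) (fun l hl => Function.update_of_ne (by omega) _ _), dotProduct_mulVec]

end Chains

theorem stmt_6 {n m p r : ℕ} (hn : 0 < n) (hm : 0 < m) (hp : 0 < p) (hr : 0 < r)
    (C : ℂ → Matrix (Fin p) (Fin n) ℂ) (K : ℂ → Matrix (Fin n) (Fin n) ℂ)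
    (B : ℂ → Matrix (Fin n) (Fin m) ℂ) (N : Fin m → ℂ → Matrix (Fin n) (Fin n) ℂ)
    (V W : Matrix (Fin n) (Fin r) ℂ)
    (k : ℕ) (hk : 0 < k) (σ : ℕ → ℂ) (d : ℕ → Fin m → ℂ) (b : Fin m → ℂ) (c : Fin p → ℂ)
    (hCa : ∀ j < k, ∀ a e, AnalyticAt ℂ (fun z => C z a e) (σ j))
    (hKa : ∀ j < k, ∀ a e, AnalyticAt ℂ (fun z => K z a e) (σ j))
    (hBa : ∀ j < k, ∀ a e, AnalyticAt ℂ (fun z => B z a e) (σ j))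
    (hNa : ∀ j < k, ∀ ι a e, AnalyticAt ℂ (fun z => N ι z a e) (σ j))
    (hK : ∀ j < k, IsUnit (K (σ j)).det)
    (hKr : ∀ j < k, IsUnit (Wᴴ * K (σ j) * V).det)
    (hV : ∀ j < k, vtan K B N σ d b j ∈ Set.range V.mulVec)
    (hW : ∀ t < k,
      wtan C K N (fun t => σ (k - 1 - t)) (fun t => d (k - 2 - t)) c t ∈
        Set.range W.mulVec) :
    (∀ i < k,
      pD i (fun s => star c ⬝ᵥ (Gmod C K B N s d (k - 1) *ᵥ b)) σ =
        pD i (fun s => star c ⬝ᵥ (Gmod (fun s => C s * V) (fun s => Wᴴ * K s * V) (fun s => Wᴴ * B s) (fun ι s => Wᴴ * N ι s * V) s d (k - 1) *ᵥ b)) σ) ∧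
    (∀ j < k - 1, ∀ i : Fin m,
      deriv (fun z =>
          star c ⬝ᵥ
            (Gmod C K B N σ (Function.update d j (Function.update (d j) i z)) (k - 1) *ᵥ
              b)) (d j i) =
        deriv (fun z =>
          star c ⬝ᵥ
            (Gmod (fun s => C s * V) (fun s => Wᴴ * K s * V) (fun s => Wᴴ * B s) (fun ι s => Wᴴ * N ι s * V) σ (Function.update d j (Function.update (d j) i z)) (k - 1) *ᵥ
              b)) (d j i)) := by
  obtain ⟨q, rfl⟩ : ∃ q, k = q + 1 := ⟨k - 1, by omega⟩
  have hq : (fun t => d (q + 1 - 2 - t)) = fun t => d (q - 1 - t) := by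
    funext t
    congr 1
  simp only [Nat.add_sub_cancel] at hW ⊢
  rw [hq] at hW
  have hv := mulVec_vtan_projected K B N V W hK hKr hV
  have hw := star_wtan_projected_vecMul C K N V W (τ := fun t => σ (q - t))
    (fun t _ => hK (q - t) (by omega)) (fun t _ => hKr (q - t) (by omega)) hW
  constructor
  · intro i hi
    obtain ⟨t, ht⟩ : ∃ t, i + t = q := ⟨q - i, by omega⟩
    have hti : q - t = i := by omega
    simp only [pD, dotProduct_Gmod_update_mulVec _ _ _ _ σ d b c ht]
    rw [funext fun z => congrArg₂ (· ⬝ᵥ ·)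
      (leftSource_projected C K N V W (fun l hl => hw l (by omega)) z)
      (congrArg ((Wᴴ * K z * V)⁻¹ *ᵥ ·)
        (rightSource_projected K B N V W (fun l hl => hv l (by omega)) z))]
    apply deriv_galerkin V W
    · cases t with
      | zero =>
        exact differentiableAt_vecMul (fun a e => (hCa i hi a e).differentiableAt) (by simp)
      | succ t =>
        exact differentiableAt_vecMul
          (differentiableAt_Nsum N _ fun ι a e => (hNa i hi ι a e).differentiableAt) (by simp)
    · cases i with
      | zero =>
        exact differentiableAt_matrix_mulVec (fun a e => (hBa 0 hi a e).differentiableAt)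
          (by simp)
      | succ i => simp [rightSource]
    · exact fun a e => (hKa i hi a e).differentiableAt
    · exact hK i hi
    · exact hKr i hi
    · rw [← vtan_eq]
      exact hV i hi
    · have h := star_wtan_eq C K N (fun t => σ (q - t)) (fun t => d (q - 1 - t)) c t
      simp only [hti] at h
      rw [← h, star_star]
      exact hW t (by omega)
  · intro j hj i
    obtain ⟨t, ht⟩ : ∃ t, j + (t + 1) = q := ⟨q - j - 1, by omega⟩
    congr 1
    funext z
    rw [dotProduct_Gmod_update_scaling_mulVec _ _ _ _ σ d b c ht,
      dotProduct_Gmod_update_scaling_mulVec _ _ _ _ σ d b c ht, Nsum_projected,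
      ← hv j (by omega), ← hw t (by omega)]
    simp only [dotProduct_mulVec, vecMul_vecMul, Matrix.mul_assoc]

end StructBilin
end

section
/- Let σ_1,…,σ_k ∈ ℂ be such that K(σ_j) and K̂(σ_j) = Wᴴ K(σ_j) V are invertible for all j = 1,…,k, and let b ∈ ℂ^m. Define recursively the matrices V_1 = K(σ_1)^{-1} B(σ_1) b ∈ ℂ^{n×1} and V_j = K(σ_j)^{-1} N(σ_{j-1}) (I_m ⊗ V_{j-1}) ∈ ℂ^{n×m^{j-1}} for 2 ≤ j ≤ k. If the columns of V_1,…,V_k all lie in the column space of V, then for every 1 ≤ q ≤ k the blockwise right tangential interpolation conditions G_q(σ_1,…,σ_q)(I_{m^{q-1}} ⊗ b) = Ĝ_q(σ_1,…,σ_q)(I_{m^{q-1}} ⊗ b) hold. -/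
open Matrix
open scoped Kronecker

namespace StructBilin

theorem Nbig_mul_one_kronecker {n m r : ℕ} (N : Fin m → ℂ → Matrix (Fin n) (Fin n) ℂ)
    (V W : Matrix (Fin n) (Fin r) ℂ) (s : ℂ) :
    Wᴴ * Nbig N s * ((1 : Matrix (Fin m) (Fin m) ℂ) ⊗ₖ V) =
      Nbig (fun ι s => Wᴴ * N ι s * V) s := by
  ext i q
  obtain ⟨a, j⟩ := q
  simp [Nbig, Matrix.mul_apply, Fintype.sum_prod_type, Matrix.one_apply, ite_mul]

/-- Petrov–Galerkin projection recovers a solution that lies in the range of `V`. -/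
theorem mul_inv_mul_eq_of_range {n r : ℕ} {α : Type*} {A : Matrix (Fin n) (Fin n) ℂ}
    {V W : Matrix (Fin n) (Fin r) ℂ} {Y : Matrix (Fin n) α ℂ}
    (hA : IsUnit A.det) (hAr : IsUnit (Wᴴ * A * V).det)
    (hY : ∀ c, (fun i => (A⁻¹ * Y) i c) ∈ Set.range V.mulVec) :
    V * ((Wᴴ * A * V)⁻¹ * (Wᴴ * Y)) = A⁻¹ * Y := by
  choose x hx using hY
  have hX : A⁻¹ * Y = V * (Matrix.of x)ᵀ := by
    ext i c
    exact (congrFun (hx c) i).symm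
  have h : Y = A * (V * (Matrix.of x)ᵀ) := by
    rw [← hX, Matrix.mul_nonsing_inv_cancel_left _ _ hA]
  have h' : Wᴴ * Y = Wᴴ * A * V * (Matrix.of x)ᵀ := by
    rw [h]
    simp only [Matrix.mul_assoc]
  rw [hX, h', Matrix.nonsing_inv_mul_cancel_left _ _ hAr]

theorem Zblk_mul_tangMat {n m : ℕ} (K : ℂ → Matrix (Fin n) (Fin n) ℂ)
    (B : ℂ → Matrix (Fin n) (Fin m) ℂ) (N : Fin m → ℂ → Matrix (Fin n) (Fin n) ℂ)
    (σ : ℕ → ℂ) (b : Fin m → ℂ) (j : ℕ) :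
    Zblk K B N σ j * tangMat b j = Vblk K B N σ b j := by
  induction j with
  | zero =>
    ext i c
    change (((K (σ 0))⁻¹ * B (σ 0)) *ᵥ b) i = ((K (σ 0))⁻¹ *ᵥ (B (σ 0) *ᵥ b)) i
    rw [Matrix.mulVec_mulVec]
  | succ j ih =>
    change (K (σ (j + 1)))⁻¹ * Nbig N (σ j) *
        ((1 : Matrix (Fin m) (Fin m) ℂ) ⊗ₖ Zblk K B N σ j) *
        ((1 : Matrix (Fin m) (Fin m) ℂ) ⊗ₖ tangMat b j) =
      (K (σ (j + 1)))⁻¹ * Nbig N (σ j) * ((1 : Matrix (Fin m) (Fin m) ℂ) ⊗ₖ Vblk K B N σ b j)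
    rw [Matrix.mul_assoc, ← Matrix.mul_kronecker_mul, ih, Matrix.one_mul]

theorem projected_recursion_step {n m r : ℕ} {α : Type*} {A : Matrix (Fin n) (Fin n) ℂ}
    {N : Fin m → ℂ → Matrix (Fin n) (Fin n) ℂ} {V W : Matrix (Fin n) (Fin r) ℂ} {s : ℂ}
    {X : Matrix (Fin n) α ℂ} {Y : Matrix (Fin r) α ℂ}
    (hA : IsUnit A.det) (hAr : IsUnit (Wᴴ * A * V).det) (hXY : V * Y = X)
    (h : ∀ c, (fun i => (A⁻¹ * Nbig N s * ((1 : Matrix (Fin m) (Fin m) ℂ) ⊗ₖ X)) i c) ∈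
      Set.range V.mulVec) :
    V * ((Wᴴ * A * V)⁻¹ * Nbig (fun ι s => Wᴴ * N ι s * V) s *
        ((1 : Matrix (Fin m) (Fin m) ℂ) ⊗ₖ Y)) =
      A⁻¹ * Nbig N s * ((1 : Matrix (Fin m) (Fin m) ℂ) ⊗ₖ X) := by
  rw [Matrix.mul_assoc A⁻¹] at h ⊢
  rw [← mul_inv_mul_eq_of_range hA hAr h, ← hXY, ← Nbig_mul_one_kronecker N V W s]
  have hkron := Matrix.mul_kronecker_mul (1 : Matrix (Fin m) (Fin m) ℂ)
    (1 : Matrix (Fin m) (Fin m) ℂ) V Y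
  rw [Matrix.one_mul] at hkron
  rw [hkron]
  simp only [Matrix.mul_assoc]

theorem mul_Vblk_projected {n m r : ℕ} {K : ℂ → Matrix (Fin n) (Fin n) ℂ}
    {B : ℂ → Matrix (Fin n) (Fin m) ℂ} {N : Fin m → ℂ → Matrix (Fin n) (Fin n) ℂ}
    {V W : Matrix (Fin n) (Fin r) ℂ} {k : ℕ} {σ : ℕ → ℂ} {b : Fin m → ℂ}
    (hK : ∀ j < k, IsUnit (K (σ j)).det)
    (hKr : ∀ j < k, IsUnit (Wᴴ * K (σ j) * V).det)
    (hV : ∀ j < k, ∀ cix : outT m j,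
      (fun i => Vblk K B N σ b j i cix) ∈ Set.range V.mulVec) (j : ℕ) (hj : j < k) :
    V * Vblk (fun s => Wᴴ * K s * V) (fun s => Wᴴ * B s) (fun ι s => Wᴴ * N ι s * V) σ b j =
      Vblk K B N σ b j := by
  induction j with
  | zero =>
    have h : V * ((Wᴴ * K (σ 0) * V)⁻¹ * (Wᴴ * (B (σ 0) * bCol b))) =
        (K (σ 0))⁻¹ * (B (σ 0) * bCol b) :=
      mul_inv_mul_eq_of_range (hK 0 hj) (hKr 0 hj) (hV 0 hj)
    rw [← Matrix.mul_assoc Wᴴ] at h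
    exact h
  | succ j ih =>
    exact projected_recursion_step (hK _ hj) (hKr _ hj) (ih (by lia)) (hV (j + 1) hj)

theorem stmt_8 {n m p r : ℕ} (hn : 0 < n) (hm : 0 < m) (hp : 0 < p) (hr : 0 < r)
    (C : ℂ → Matrix (Fin p) (Fin n) ℂ) (K : ℂ → Matrix (Fin n) (Fin n) ℂ)
    (B : ℂ → Matrix (Fin n) (Fin m) ℂ) (N : Fin m → ℂ → Matrix (Fin n) (Fin n) ℂ)
    (V W : Matrix (Fin n) (Fin r) ℂ)
    (k : ℕ) (hk : 0 < k) (σ : ℕ → ℂ) (b : Fin m → ℂ)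
    (hK : ∀ j < k, IsUnit (K (σ j)).det)
    (hKr : ∀ j < k, IsUnit (Wᴴ * K (σ j) * V).det)
    (hV : ∀ j < k, ∀ cix : outT m j,
      (fun i => Vblk K B N σ b j i cix) ∈ Set.range V.mulVec) :
    ∀ q < k,
      Gblk C K B N σ q * tangMat b q =
        Gblk (fun s => C s * V) (fun s => Wᴴ * K s * V) (fun s => Wᴴ * B s) (fun ι s => Wᴴ * N ι s * V) σ q * tangMat b q := by
  intro q hq
  rw [Gblk, Gblk, Matrix.mul_assoc, Matrix.mul_assoc, Zblk_mul_tangMat, Zblk_mul_tangMat,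
    Matrix.mul_assoc, mul_Vblk_projected hK hKr hV q hq]

end StructBilin
end
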